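/- arXiv:1801.07163 — 5 statements merged into one kernel-verified Lean document; each statement's English description precedes it below -/
import Mathlib

section
/- (Theorem 1.1, coefficient form) For all integers n ≥ 0 and m ≥ 0, ∑_{w ∈ I_n^B} C(n + m − des_B(w), n) = ∑_{j=0}^{⌊n/2⌋} C(m^2 + j − 1, j) · C(2m + n − 2j, n − 2j), where C(a,b) denotes the binomial coefficient, equal to 0 when a < b. -/
open scoped Classical

/-- `Ω_n = {±1, …, ±n}` as a subset of `ℤ`. -/
def OmegaSet (n : ℕ) : Set ℤ := {a : ℤ | 1 ≤ |a| ∧ |a| ≤ (n : ℤ)}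

/-- A signed permutation of length `n`: a bijection of `Ω_n` satisfying `w(-a) = -w(a)`,
extended by the identity outside `Ω_n`. -/
def IsSignedPerm (n : ℕ) (w : ℤ → ℤ) : Prop :=
  (∀ a : ℤ, w (-a) = -w a) ∧ Set.BijOn w (OmegaSet n) (OmegaSet n) ∧
    ∀ a : ℤ, a ∉ OmegaSet n → w a = a

/-- An involution in the hyperoctahedral group `B_n`. -/
def IsSignedInvolution (n : ℕ) (w : ℤ → ℤ) : Prop :=
  IsSignedPerm n w ∧ ∀ a : ℤ, w (w a) = a

/-- The total order `-1 <_r -2 <_r ⋯ <_r 0 <_r 1 <_r 2 <_r ⋯` on `ℤ`. -/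
def rlt (a b : ℤ) : Prop :=
  (a < 0 ∧ b < 0 ∧ b < a) ∨ (a < 0 ∧ 0 ≤ b) ∨ (0 ≤ a ∧ 0 ≤ b ∧ a < b)

/-- `des_B(w) = #{ i ∈ {0,…,n-1} : w(i) >_r w(i+1) }` (with `w(0) = 0`, which is forced by
antisymmetry). -/
noncomputable def desB (n : ℕ) (w : ℤ → ℤ) : ℕ :=
  ((Finset.range n).filter fun i : ℕ => rlt (w ((i : ℤ) + 1)) (w (i : ℤ))).card

/-- `I_{n,k}^B`, the number of involutions `w` in `B_n` with `des_B(w) = k`. -/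
noncomputable def InkB (n k : ℕ) : ℕ :=
  {w : ℤ → ℤ | IsSignedInvolution n w ∧ desB n w = k}.ncard


/-- Monotone `n`-tuples are the same as multisets of size `n`. -/
noncomputable def monotoneEquivSym (α : Type*) [LinearOrder α] (n : ℕ) :
    {g : Fin n → α // Monotone g} ≃ Sym α n :=
  Equiv.ofBijective (fun g => ⟨Finset.univ.val.map g.1, by simp⟩) <| by
    constructor
    · rintro ⟨g, hg⟩ ⟨h, hh⟩ H
      have H' : (List.ofFn g : Multiset α) = List.ofFn h := by
        rw [← Fin.univ_val_map, ← Fin.univ_val_map]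
        exact congrArg Sym.toMultiset H
      have := (Multiset.coe_eq_coe.1 H').eq_of_sortedLE hg.sortedLE_ofFn hh.sortedLE_ofFn
      exact Subtype.ext (List.ofFn_injective this)
    · rintro ⟨S, hS⟩
      have hl : (S.sort (· ≤ ·)).length = n := by simpa using hS
      have hsort : List.ofFn (fun i : Fin n => (S.sort (· ≤ ·)).get (i.cast hl.symm)) =
          S.sort (· ≤ ·) := by
        subst hl
        exact List.ofFn_get _
      refine ⟨⟨fun i => (S.sort (· ≤ ·)).get (i.cast hl.symm), ?_⟩, ?_⟩
      · rw [← List.sortedLE_ofFn_iff, hsort]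
        exact (S.pairwise_sort (· ≤ ·)).sortedLE
      · apply Subtype.ext
        simp only [Fin.univ_val_map]
        rw [hsort, Multiset.sort_eq]

@[simp]
lemma coe_monotoneEquivSym {α : Type*} [LinearOrder α] {n : ℕ}
    (g : {g : Fin n → α // Monotone g}) :
    (monotoneEquivSym α n g : Multiset α) = Finset.univ.val.map g.1 := rfl

lemma card_monotone_tuples (k n : ℕ) :
    Nat.card {g : Fin n → Fin k // Monotone g} = k.multichoose n := by
  rw [Nat.card_congr (monotoneEquivSym (Fin k) n), Nat.card_eq_fintype_card,
    Sym.card_sym_eq_multichoose, Fintype.card_fin]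

section InvariantMultisets

variable {α : Type*} [LinearOrder α] {τ : α → α}

/-- The `τ`-symmetric multiset made of the points of `A`, their images, and the points of `B`. -/
def symmetrize (τ : α → α) (A : Multiset {a // a < τ a}) (B : Multiset {a // τ a = a}) :
    Multiset α :=
  A.map Subtype.val + (A.map Subtype.val).map τ + B.map Subtype.val

lemma card_symmetrize (A : Multiset {a // a < τ a}) (B : Multiset {a // τ a = a}) :
    (symmetrize τ A B).card = 2 * A.card + B.card := by
  simp [symmetrize]; ring

lemma map_symmetrize (hτ : Function.Involutive τ) (A : Multiset {a // a < τ a})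
    (B : Multiset {a // τ a = a}) : (symmetrize τ A B).map τ = symmetrize τ A B := by
  have hB : (B.map Subtype.val).map τ = B.map Subtype.val := by
    rw [Multiset.map_map]
    exact Multiset.map_congr rfl fun x _ => x.2
  have hA : ((A.map Subtype.val).map τ).map τ = A.map Subtype.val := by
    rw [Multiset.map_map, hτ.comp_self, Multiset.map_id]
  rw [symmetrize, Multiset.map_add, Multiset.map_add, hB, hA,
    add_comm ((A.map Subtype.val).map τ)]

lemma symmetrize_injective (hτ : Function.Involutive τ) {A A' : Multiset {a // a < τ a}}
    {B B' : Multiset {a // τ a = a}} (h : symmetrize τ A B = symmetrize τ A' B') :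
    A = A' ∧ B = B' := by
  have hlt (A : Multiset {a // a < τ a}) (B : Multiset {a // τ a = a}) :
      (symmetrize τ A B).filter (fun a => a < τ a) = A.map Subtype.val := by
    rw [symmetrize, Multiset.filter_add, Multiset.filter_add, Multiset.filter_eq_self.2,
      Multiset.filter_eq_nil.2, Multiset.filter_eq_nil.2]
    · simp
    · simp +contextual
    · simp only [Multiset.mem_map]
      rintro _ ⟨_, ⟨x, -, rfl⟩, rfl⟩
      rw [hτ]
      exact x.2.not_gt
    · simp only [Multiset.mem_map]
      rintro _ ⟨x, -, rfl⟩
      exact x.2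
  have hA : A = A' := Multiset.map_injective Subtype.val_injective <| by
    rw [← hlt A B, ← hlt A' B', h]
  subst hA
  exact ⟨rfl, Multiset.map_injective Subtype.val_injective (add_left_cancel h)⟩

lemma exists_symmetrize_eq (hτ : Function.Involutive τ) {S : Multiset α} (hS : S.map τ = S) :
    ∃ A B, symmetrize τ A B = S := by
  have lift (p : α → Prop) [DecidablePred p] :
      ∃ A : Multiset {a // p a}, A.map Subtype.val = S.filter p :=
    CanLift.prf (S.filter p) fun a ha => (Multiset.mem_filter.1 ha).2
  obtain ⟨A, hA⟩ := lift fun a => a < τ a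
  obtain ⟨B, hB⟩ := lift fun a => τ a = a
  refine ⟨A, B, ?_⟩
  have hgt : (A.map Subtype.val).map τ = S.filter fun a => τ a < a := by
    conv_rhs => rw [← hS, Multiset.filter_map]
    rw [hA]
    congr 1
    refine Multiset.filter_congr fun a _ => ?_
    simp [hτ a]
  rw [symmetrize, hgt, hA, hB]
  ext a
  simp only [Multiset.count_add, Multiset.count_filter]
  rcases lt_trichotomy a (τ a) with h | h | h
  · simp [h, h.not_gt, h.ne']
  · simp [← h]
  · simp [h, h.not_gt, h.ne]

lemma card_invariant_sym [Fintype α] (hτ : Function.Involutive τ) (n : ℕ) :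
    Nat.card {S : Sym α n // (S : Multiset α).map τ = S} =
      ∑ j ∈ Finset.range (n / 2 + 1),
        (Nat.card {a // a < τ a}).multichoose j *
          (Nat.card {a // τ a = a}).multichoose (n - 2 * j) := by
  let F : (Σ j : Fin (n / 2 + 1), Sym {a // a < τ a} j × Sym {a // τ a = a} (n - 2 * j)) →
      {S : Sym α n // (S : Multiset α).map τ = S} := fun x =>
    ⟨⟨symmetrize τ x.2.1 x.2.2, by
      have h1 : (x.2.1 : Multiset {a // a < τ a}).card = x.1 := x.2.1.2
      have h2 : (x.2.2 : Multiset {a // τ a = a}).card = n - 2 * x.1 := x.2.2.2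
      rw [card_symmetrize, h1, h2]
      omega⟩, map_symmetrize hτ _ _⟩
  have hF : Function.Bijective F := by
    constructor
    · rintro ⟨j, A, B⟩ ⟨j', A', B'⟩ h
      have h' : symmetrize τ (A : Multiset _) B = symmetrize τ A' B' :=
        congrArg (fun S => (S.1 : Multiset α)) h
      obtain ⟨hA, hB⟩ := symmetrize_injective hτ h'
      have hj : j = j' := Fin.ext <| by rw [← A.2, ← A'.2]; exact congrArg _ hA
      subst hj
      rw [Sym.coe_injective hA, Sym.coe_injective hB]
    · rintro ⟨⟨S, hS⟩, hτS⟩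
      obtain ⟨A, B, rfl⟩ := exists_symmetrize_eq hτ hτS
      rw [card_symmetrize] at hS
      exact ⟨⟨⟨A.card, by omega⟩, ⟨A, rfl⟩, ⟨B, by simp only; omega⟩⟩, rfl⟩
  rw [← Nat.card_congr (Equiv.ofBijective F hF), Nat.card_sigma, Finset.sum_range]
  refine Finset.sum_congr rfl fun j _ => ?_
  rw [Nat.card_prod]
  simp only [Nat.card_eq_fintype_card, Sym.card_sym_eq_multichoose]

end InvariantMultisets

section CompatibleSequences

variable {n m : ℕ} {D : ℕ → Prop} [DecidablePred D]

/-- `0 ≤ f 0 ≤ f 1 ≤ ⋯ ≤ f (n - 1)`, where the inequality ending at `f i` is strict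
if `D i` holds. -/
def IsCompatible (D : ℕ → Prop) [DecidablePred D] (f : Fin n → Fin (m + 1)) : Prop :=
  (∀ i : Fin n, Nat.count D (i + 1) ≤ f i) ∧
    ∀ i j : Fin n, i ≤ j → (f i : ℕ) + Nat.count D (j + 1) ≤ f j + Nat.count D (i + 1)

lemma card_isCompatible (n m : ℕ) (D : ℕ → Prop) [DecidablePred D] :
    Nat.card {f : Fin n → Fin (m + 1) // IsCompatible D f} =
      (n + m - Nat.count D n).choose n := by
  have hcn : Nat.count D n ≤ n := Nat.count_le D
  rcases le_or_gt (Nat.count D n) m with hc | hc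
  · have hmono : Monotone (Nat.count D) := Nat.count_monotone D
    have key (f : {f : Fin n → Fin (m + 1) // IsCompatible D f}) (i : Fin n) :
        (f.1 i : ℕ) + Nat.count D n ≤ m + Nat.count D (i + 1) := by
      have hn : 0 < n := i.pos
      have h := f.2.2 i ⟨n - 1, by omega⟩ (Fin.le_def.2 (by simp only; omega))
      have h1 : n - 1 + 1 = n := by omega
      have h2 := (f.1 ⟨n - 1, by omega⟩).2
      simp only [h1] at h
      omega
    let e : {f : Fin n → Fin (m + 1) // IsCompatible D f} ≃
        {g : Fin n → Fin (m - Nat.count D n + 1) // Monotone g} :=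
      { toFun f := ⟨fun i => ⟨f.1 i - Nat.count D (i + 1), by have := key f i; omega⟩,
          fun i j hij => Fin.le_def.2 <| by
            have := f.2.2 i j hij
            have := f.2.1 i
            have := f.2.1 j
            simp only
            omega⟩
        invFun g := ⟨fun i => ⟨g.1 i + Nat.count D (i + 1), by
            have : Nat.count D (i + 1) ≤ Nat.count D n := hmono (by omega)
            omega⟩,
          fun i => by simp, fun i j hij => by
            have : (g.1 i : ℕ) ≤ g.1 j := g.2 hij
            simp only
            omega⟩
        left_inv f := by
          ext i
          have := f.2.1 i
          simp only
          omega
        right_inv g := by ext i; simp }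
    rw [Nat.card_congr e, card_monotone_tuples, Nat.multichoose_eq]
    congr 1
    omega
  · rw [Nat.choose_eq_zero_of_lt (by omega)]
    have : IsEmpty {f : Fin n → Fin (m + 1) // IsCompatible D f} := ⟨fun f => by
      have h := f.2.1 ⟨n - 1, by omega⟩
      have h1 : n - 1 + 1 = n := by omega
      have h2 := (f.1 ⟨n - 1, by omega⟩).2
      simp only [h1] at h
      omega⟩
    exact Nat.card_of_isEmpty

/-- When `D` is the descent set of a sequence of distinct keys, compatibility says that the
keys increase wherever `f` is constant. -/
lemma isCompatible_iff {K : Type*} [LinearOrder K] {k : Fin n → K} (hk : Function.Injective k)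
    {P : 0 < n → Prop} (hD0 : ∀ h, D 0 ↔ P h)
    (hD : ∀ i (h : i + 1 < n), D (i + 1) ↔ k ⟨i + 1, h⟩ < k ⟨i, by omega⟩)
    {f : Fin n → Fin (m + 1)} :
    IsCompatible D f ↔ Monotone f ∧ (∀ i j, i < j → f i = f j → k i < k j) ∧
      ∀ h : 0 < n, P h → f ⟨0, h⟩ ≠ 0 := by
  have hmono : Monotone (Nat.count D) := Nat.count_monotone D
  constructor
  · rintro ⟨h0, h1⟩
    have hf : Monotone f := fun i j hij => Fin.le_def.2 <| by
      have := h1 i j hij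
      have : Nat.count D (i + 1) ≤ Nat.count D (j + 1) := hmono (by simpa using hij)
      omega
    refine ⟨hf, ?_, fun hn hP hfz => ?_⟩
    · have step (l : ℕ) (hl : l + 1 < n) (e : f ⟨l, by omega⟩ = f ⟨l + 1, hl⟩) :
          k ⟨l, by omega⟩ < k ⟨l + 1, hl⟩ := by
        have h := h1 ⟨l, by omega⟩ ⟨l + 1, hl⟩ (Fin.le_def.2 (by simp))
        rw [e] at h
        simp only [Nat.count_succ D (l + 1)] at h
        have hn : ¬ D (l + 1) := fun hd => by simp [hd] at h
        rw [hD l hl, not_lt] at hn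
        exact lt_of_le_of_ne hn fun h => by simpa using hk h
      suffices ∀ (i j : ℕ) (hij : i + 1 ≤ j) (hj : j < n),
          f ⟨i, by omega⟩ = f ⟨j, hj⟩ → k ⟨i, by omega⟩ < k ⟨j, hj⟩ from
        fun i j hij => this i j hij j.2
      intro i j hij
      induction j, hij using Nat.le_induction with
      | base => exact fun hj => step i hj
      | succ j hij ih =>
        intro hj e
        have e1 : f ⟨i, by omega⟩ ≤ f ⟨j, by omega⟩ := hf (Fin.le_def.2 (by simp only; omega))
        have e2 : f ⟨j, by omega⟩ ≤ f ⟨j + 1, hj⟩ := hf (Fin.le_def.2 (by simp))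
        have e3 : f ⟨i, by omega⟩ = f ⟨j, by omega⟩ := le_antisymm e1 (e ▸ e2)
        exact (ih (by omega) e3).trans (step j hj (e3 ▸ e))
    · have h := h0 ⟨0, hn⟩
      rw [hfz] at h
      simp only [Nat.count_succ, Nat.count_zero, (hD0 hn).2 hP, if_true, Fin.val_zero] at h
      omega
  · rintro ⟨hf, hk', hP⟩
    have step (l : ℕ) (hl : l + 1 < n) :
        (f ⟨l, by omega⟩ : ℕ) + Nat.count D (l + 1 + 1) ≤ f ⟨l + 1, hl⟩ + Nat.count D (l + 1) := by
      have h1 : f ⟨l, by omega⟩ ≤ f ⟨l + 1, hl⟩ := hf (Fin.le_def.2 (by simp))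
      rw [Nat.count_succ D (l + 1)]
      split_ifs with hd
      · have h2 : f ⟨l, by omega⟩ ≠ f ⟨l + 1, hl⟩ := fun e =>
          ((hD l hl).1 hd).not_gt (hk' _ _ (Fin.lt_def.2 (by simp)) e)
        have h3 := Fin.lt_def.1 (lt_of_le_of_ne h1 h2)
        omega
      · have h3 := Fin.le_def.1 h1
        omega
    have hle (i j : ℕ) (hij : i ≤ j) : ∀ hj : j < n,
        (f ⟨i, by omega⟩ : ℕ) + Nat.count D (j + 1) ≤ f ⟨j, hj⟩ + Nat.count D (i + 1) := by
      induction j, hij using Nat.le_induction with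
      | base => exact fun _ => le_rfl
      | succ j hij ih =>
        intro hj
        have := ih (by omega)
        have := step j hj
        omega
    refine ⟨fun i => ?_, fun i j hij => hle i j hij j.2⟩
    have hn : 0 < n := i.pos
    have h := hle 0 i (Nat.zero_le _) i.2
    have h0 : Nat.count D (0 + 1) ≤ f ⟨0, hn⟩ := by
      rw [Nat.count_succ, Nat.count_zero]
      split_ifs with hd
      · have := hP hn ((hD0 hn).1 hd)
        have := Fin.pos_iff_ne_zero.2 this
        exact this
      · simp
    simp only [Fin.eta] at h
    omega

end CompatibleSequences

section StandardInvolution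

variable {α : Type*} [LinearOrder α] {τ : α → α} {n : ℕ} {g : Fin n → α}

lemma comp_sort_eq_of_map_eq (hg : Monotone g)
    (h : Finset.univ.val.map (τ ∘ g) = Finset.univ.val.map g) :
    (τ ∘ g) ∘ Tuple.sort (τ ∘ g) = g := by
  have H : monotoneEquivSym α n ⟨_, Tuple.monotone_sort (τ ∘ g)⟩ =
      monotoneEquivSym α n ⟨g, hg⟩ := by
    apply Sym.coe_injective
    rw [coe_monotoneEquivSym, coe_monotoneEquivSym, ← h, ← Multiset.map_map,
      Multiset.map_univ_val_equiv]
  exact congrArg Subtype.val ((monotoneEquivSym α n).injective H)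

lemma sort_symm_eq (hτ : Function.Involutive τ) (hg : Monotone g)
    (h : (τ ∘ g) ∘ Tuple.sort (τ ∘ g) = g) :
    (Tuple.sort (τ ∘ g)).symm = Tuple.sort (τ ∘ g) := by
  set σ := Tuple.sort (τ ∘ g) with hσ
  obtain ⟨-, hst⟩ := Tuple.eq_sort_iff.1 hσ
  have h1 (i : Fin n) : g i = τ (g (σ i)) := (congrFun h i).symm
  have h2 (i : Fin n) : τ (g (σ.symm i)) = g i := by rw [h1, hτ, σ.apply_symm_apply]
  have h3 : (τ ∘ g) ∘ σ.symm = g := funext h2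
  refine Tuple.eq_sort_iff.2 ⟨by rwa [h3], fun i j hij e => ?_⟩
  by_contra! hle
  have hne : σ.symm j ≠ σ.symm i := fun e' => hij.ne' (σ.symm.injective e')
  have := hst _ _ (lt_of_le_of_ne hle hne) (by
    simp only [Function.comp_apply, σ.apply_symm_apply]
    simp only [Function.comp_apply, h2] at e
    rw [e])
  simp only [σ.apply_symm_apply] at this
  exact this.not_gt hij

end StandardInvolution

section Biletters

/-- Biletters `(a, ±b)` with `0 ≤ a, b ≤ m`, where the sign may be negative (encoded by `false`)
only when `a` and `b` are both nonzero. -/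
abbrev Biletter (m : ℕ) :=
  {t : Fin (m + 1) ×ₗ Bool ×ₗ Fin (m + 1) //
    (ofLex (ofLex t).2).1 = false → (ofLex t).1 ≠ 0 ∧ (ofLex (ofLex t).2).2 ≠ 0}

namespace Biletter

variable {m : ℕ}

/-- The biletter with given entries. -/
def mk (a : Fin (m + 1)) (s : Bool) (b : Fin (m + 1)) (h : s = false → a ≠ 0 ∧ b ≠ 0) :
    Biletter m := ⟨toLex (a, toLex (s, b)), h⟩

/-- The upper entry of a biletter. -/
def top (t : Biletter m) : Fin (m + 1) := (ofLex t.1).1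

/-- The sign of a biletter. -/
def sign (t : Biletter m) : Bool := (ofLex (ofLex t.1).2).1

/-- The lower entry of a biletter. -/
def bot (t : Biletter m) : Fin (m + 1) := (ofLex (ofLex t.1).2).2

@[simp] lemma top_mk (a : Fin (m + 1)) (s b h) : (mk a s b h).top = a := rfl
@[simp] lemma sign_mk (a : Fin (m + 1)) (s b h) : (mk a s b h).sign = s := rfl
@[simp] lemma bot_mk (a : Fin (m + 1)) (s b h) : (mk a s b h).bot = b := rfl

lemma ne_zero (t : Biletter m) (h : t.sign = false) : t.top ≠ 0 ∧ t.bot ≠ 0 := t.2 h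

@[ext] lemma ext {t u : Biletter m} (h₁ : t.top = u.top) (h₂ : t.sign = u.sign)
    (h₃ : t.bot = u.bot) : t = u :=
  Subtype.ext (congrArg toLex (Prod.ext h₁ (congrArg toLex (Prod.ext h₂ h₃))))

lemma le_iff {t u : Biletter m} :
    t ≤ u ↔ t.top < u.top ∨ t.top = u.top ∧
      (t.sign < u.sign ∨ t.sign = u.sign ∧ t.bot ≤ u.bot) := by
  rw [← Subtype.coe_le_coe, Prod.Lex.le_iff, Prod.Lex.le_iff]
  rfl

/-- Exchange the two entries of a biletter. -/
def swap (t : Biletter m) : Biletter m :=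
  mk t.bot t.sign t.top fun h => (t.ne_zero h).symm

@[simp] lemma top_swap (t : Biletter m) : t.swap.top = t.bot := rfl
@[simp] lemma sign_swap (t : Biletter m) : t.swap.sign = t.sign := rfl
@[simp] lemma bot_swap (t : Biletter m) : t.swap.bot = t.top := rfl

lemma swap_involutive : Function.Involutive (swap (m := m)) := fun _ => rfl

lemma swap_eq_iff {t : Biletter m} : t.swap = t ↔ t.bot = t.top :=
  ⟨fun h => congrArg top h, fun h => ext h rfl h.symm⟩

lemma lt_swap_iff {t : Biletter m} : t < t.swap ↔ t.top < t.bot := by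
  rw [lt_iff_not_ge, le_iff]
  simp only [top_swap, sign_swap, bot_swap, lt_irrefl, true_and, false_or]
  constructor
  · intro h
    by_contra! h'
    exact h (h'.lt_or_eq.imp id fun e => ⟨e, e.ge⟩)
  · rintro h (h' | ⟨h', -⟩)
    · exact h'.not_gt h
    · exact h.ne' h'

lemma card_swap_eq : Nat.card {t : Biletter m // t.swap = t} = 2 * m + 1 := by
  let e : {t : Biletter m // t.swap = t} ≃ Fin (m + 1) ⊕ Fin m :=
    { toFun t := if h : t.1.sign = false then .inr (t.1.top.pred (t.1.ne_zero h).1)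
        else .inl t.1.top
      invFun := Sum.elim (fun a => ⟨mk a true a (by simp), rfl⟩)
        (fun a => ⟨mk a.succ false a.succ (by simp), rfl⟩)
      left_inv t := by
        obtain ⟨t, ht⟩ := t
        rw [swap_eq_iff] at ht
        by_cases h : t.sign = false
        · simp only [h, dite_true, Sum.elim_inr, Fin.succ_pred]
          exact Subtype.ext (ext rfl h.symm ht.symm)
        · simp only [h]
          exact Subtype.ext (ext rfl (by simpa using Eq.symm (by simpa using h)) ht.symm)
      right_inv x := by
        rcases x with a | a <;> simp }
  rw [Nat.card_congr e, Nat.card_eq_fintype_card]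
  simp
  ring

lemma card_lt_swap : Nat.card {t : Biletter m // t < t.swap} = m ^ 2 := by
  let F : Fin m × Fin m → {t : Biletter m // t < t.swap} := fun x =>
    if h : x.1 ≤ x.2 then
      ⟨mk x.1.castSucc true x.2.succ (by simp), lt_swap_iff.2 (Fin.castSucc_lt_succ_iff.2 h)⟩
    else
      ⟨mk x.2.succ false x.1.succ (by simp),
        lt_swap_iff.2 (Fin.succ_lt_succ_iff.2 (not_le.1 h))⟩
  have hF : Function.Bijective F := by
    constructor
    · intro x y h
      have h0 := congrArg Subtype.val h
      have h1 := congrArg top h0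
      have h2 := congrArg sign h0
      have h3 := congrArg bot h0
      by_cases hx : x.1 ≤ x.2 <;> by_cases hy : y.1 ≤ y.2 <;>
        simp [F, hx, hy] at h1 h2 h3 <;> exact Prod.ext (by assumption) (by assumption)
    · rintro ⟨t, ht⟩
      have hlt := lt_swap_iff.1 ht
      have hb : t.bot ≠ 0 := ((Fin.zero_le _).trans_lt hlt).ne'
      by_cases h : t.sign = false
      · have ha := (t.ne_zero h).1
        have hlt' : t.top.pred ha < t.bot.pred hb := Fin.pred_lt_pred_iff.2 hlt
        refine ⟨(t.bot.pred hb, t.top.pred ha), Subtype.ext ?_⟩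
        simp only [F, hlt'.not_ge, dite_false]
        apply ext <;> simp [h]
      · have ha : t.top ≠ Fin.last m := (hlt.trans_le (Fin.le_last _)).ne
        have hle : t.top.castPred ha ≤ t.bot.pred hb := by
          rw [← Fin.castSucc_lt_succ_iff]; simpa using hlt
        refine ⟨(t.top.castPred ha, t.bot.pred hb), Subtype.ext ?_⟩
        simp only [F, hle, dite_true]
        apply ext <;> simp_all
  rw [← Nat.card_congr (Equiv.ofBijective F hF), Nat.card_prod]
  simp [sq]

end Biletter

end Biletters

section InvolutionData

/-- The data of an involution in `B_n`: the absolute values and the signs of its entries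
(with `false` for negative entries). -/
abbrev InvolutionData (n : ℕ) :=
  {p : Equiv.Perm (Fin n) × (Fin n → Bool) //
    (∀ i, p.1 (p.1 i) = i) ∧ ∀ i, p.2 (p.1 i) = p.2 i}

namespace InvolutionData

variable {n m : ℕ}

/-- The `i`-th entry as an element of the alphabet `-1 < -2 < ⋯ < -n < 1 < 2 < ⋯ < n`. -/
def key (p : InvolutionData n) (i : Fin n) : Bool ×ₗ Fin n := toLex (p.1.2 i, p.1.1 i)

lemma key_injective (p : InvolutionData n) : Function.Injective p.key := fun _ _ h =>
  p.1.1.injective (congrArg (fun x => (ofLex x).2) h)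

lemma key_lt_iff (p : InvolutionData n) {i j : Fin n} :
    p.key i < p.key j ↔ p.1.2 i < p.1.2 j ∨ p.1.2 i = p.1.2 j ∧ p.1.1 i < p.1.1 j :=
  Prod.Lex.lt_iff

/-- The tuples of values compatible with an involution. -/
def IsLabelling (p : InvolutionData n) (f : Fin n → Fin (m + 1)) : Prop :=
  Monotone f ∧ (∀ i j, i < j → f i = f j → p.key i < p.key j) ∧
    ∀ h : 0 < n, p.1.2 ⟨0, h⟩ = false → f ⟨0, h⟩ ≠ 0

lemma IsLabelling.ne_zero {p : InvolutionData n} {f : Fin n → Fin (m + 1)}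
    (hf : p.IsLabelling f) {i : Fin n} (hi : p.1.2 i = false) : f i ≠ 0 := by
  intro h0
  obtain ⟨h1, h2, h3⟩ := hf
  have hn : 0 < n := i.pos
  have hz : f ⟨0, hn⟩ = 0 := Fin.le_zero_iff.1 (h0 ▸ h1 (Fin.le_def.2 (Nat.zero_le _)))
  refine h3 hn ?_ hz
  rcases (Nat.zero_le i.1).eq_or_lt with hi0 | hi0
  · rwa [show (⟨0, hn⟩ : Fin n) = i from Fin.ext hi0]
  · have := (key_lt_iff p).1 (h2 ⟨0, hn⟩ i (Fin.lt_def.2 hi0) (hz.trans h0.symm))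
    rw [hi] at this
    exact this.elim (fun h => absurd h (Bool.false_le _).not_gt) And.left

/-- The biletters `(f i, ±f (σ i))` attached to a labelled involution. -/
def biletter {p : InvolutionData n} {f : Fin n → Fin (m + 1)} (hf : p.IsLabelling f) (i : Fin n) :
    Biletter m :=
  .mk (f i) (p.1.2 i) (f (p.1.1 i)) fun h =>
    ⟨hf.ne_zero h, hf.ne_zero ((p.2.2 i).trans h)⟩

lemma monotone_biletter {p : InvolutionData n} {f : Fin n → Fin (m + 1)} (hf : p.IsLabelling f) :
    Monotone (biletter hf) := by
  intro i j hij
  rcases hij.eq_or_lt with rfl | hij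
  · exact le_rfl
  rw [Biletter.le_iff]
  rcases (hf.1 hij.le).lt_or_eq with h | h
  · exact .inl h
  · refine .inr ⟨h, ?_⟩
    exact (p.key_lt_iff.1 (hf.2.1 i j hij h)).imp id fun h' => ⟨h'.1, hf.1 h'.2.le⟩

lemma swap_biletter {p : InvolutionData n} {f : Fin n → Fin (m + 1)} (hf : p.IsLabelling f)
    (i : Fin n) : (biletter hf (p.1.1 i)).swap = biletter hf i :=
  Biletter.ext (congrArg f (p.2.1 i)) (p.2.2 i) rfl

lemma sort_swap_biletter {p : InvolutionData n} {f : Fin n → Fin (m + 1)}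
    (hf : p.IsLabelling f) : p.1.1 = Tuple.sort (Biletter.swap ∘ biletter hf) := by
  refine Tuple.eq_sort_iff.2 ⟨?_, fun i j hij e => ?_⟩
  · have h : (Biletter.swap ∘ biletter hf) ∘ p.1.1 = biletter hf := funext (swap_biletter hf)
    exact h.symm.subst (monotone_biletter hf)
  · simp only [Function.comp_apply, swap_biletter] at e
    have h1 : f i = f j := congrArg Biletter.top e
    have h2 : p.1.2 i = p.1.2 j := congrArg Biletter.sign e
    have := p.key_lt_iff.1 (hf.2.1 i j hij h1)
    simpa [h2] using this

lemma card_labelled (n m : ℕ) :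
    Nat.card (Σ p : InvolutionData n, {f : Fin n → Fin (m + 1) // p.IsLabelling f}) =
      Nat.card {S : Sym (Biletter m) n // (S : Multiset (Biletter m)).map Biletter.swap = S} := by
  let e : {g : {g : Fin n → Biletter m // Monotone g} //
        Finset.univ.val.map (Biletter.swap ∘ g.1) = Finset.univ.val.map g.1} ≃
      {S : Sym (Biletter m) n // (S : Multiset (Biletter m)).map Biletter.swap = S} :=
    (monotoneEquivSym (Biletter m) n).subtypeEquiv fun g => by
      rw [coe_monotoneEquivSym, Multiset.map_map]
  rw [← Nat.card_congr e]
  let F : (Σ p : InvolutionData n, {f : Fin n → Fin (m + 1) // p.IsLabelling f}) →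
      {g : {g : Fin n → Biletter m // Monotone g} //
        Finset.univ.val.map (Biletter.swap ∘ g.1) = Finset.univ.val.map g.1} := fun x =>
    ⟨⟨biletter x.2.2, monotone_biletter x.2.2⟩, by
      conv_lhs => rw [← Multiset.map_univ_val_equiv x.1.1.1, Multiset.map_map]
      exact Multiset.map_congr rfl fun i _ => swap_biletter x.2.2 i⟩
  refine Nat.card_congr (Equiv.ofBijective F ⟨?_, ?_⟩)
  · rintro ⟨p, f, hf⟩ ⟨p', f', hf'⟩ h
    have hg : biletter hf = biletter hf' := congrArg (fun g => g.1.1) h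
    have h1 : f = f' := funext fun i => congrArg Biletter.top (congrFun hg i)
    have h2 : p.1.2 = p'.1.2 := funext fun i => congrArg Biletter.sign (congrFun hg i)
    have h3 : p.1.1 = p'.1.1 := by rw [sort_swap_biletter hf, sort_swap_biletter hf', hg]
    have h4 : p = p' := Subtype.ext (Prod.ext h3 h2)
    subst h4 h1
    rfl
  · rintro ⟨⟨g, hg⟩, hτ⟩
    have h := comp_sort_eq_of_map_eq hg hτ
    have hsymm := sort_symm_eq Biletter.swap_involutive hg h
    have hst := (Tuple.eq_sort_iff.1 (rfl : Tuple.sort (Biletter.swap ∘ g) = _)).2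
    set σ := Tuple.sort (Biletter.swap ∘ g)
    have h1 (i : Fin n) : (g (σ i)).swap = g i := congrFun h i
    have h1' (i : Fin n) : (g i).bot = (g (σ i)).top := by rw [← h1 i]; rfl
    have hσ (i : Fin n) : σ (σ i) = i := by
      simpa only [hsymm] using σ.symm_apply_apply i
    let p : InvolutionData n := ⟨(σ, fun i => (g i).sign), hσ, fun i =>
      (congrArg Biletter.sign (h1 i) :)⟩
    have hp : p.IsLabelling fun i => (g i).top := by
      refine ⟨fun _ _ hij => ?_, fun i j hij e => ?_, fun hn h0 => ((g _).ne_zero h0).1⟩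
      · rcases Biletter.le_iff.1 (hg hij) with h | h
        exacts [h.le, h.1.le]
      · rw [key_lt_iff]
        rcases Biletter.le_iff.1 (hg hij.le) with h | ⟨-, h | ⟨hs, hb⟩⟩
        · exact absurd e h.ne
        · exact .inl h
        · refine .inr ⟨hs, ?_⟩
          rcases hb.lt_or_eq with hb | hb
          · rw [h1', h1'] at hb
            by_contra! hle
            rcases Biletter.le_iff.1 (hg hle) with h | h
            exacts [h.not_gt hb, hb.ne' h.1]
          · refine hst i j hij ?_
            simp only [Function.comp_apply, h1]
            exact Biletter.ext e hs hb
    refine ⟨⟨p, _, hp⟩, ?_⟩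
    apply Subtype.ext
    apply Subtype.ext
    funext i
    exact Biletter.ext rfl rfl (h1' i).symm

end InvolutionData

end InvolutionData

section SignedInvolutions

variable {n m : ℕ}

/-- The element `±(i + 1)` of `Ω_n`. -/
def signedEntry (i : Fin n) (s : Bool) : ℤ := if s then (i : ℤ) + 1 else -((i : ℤ) + 1)

lemma mem_omegaSet_iff_natAbs {a : ℤ} : a ∈ OmegaSet n ↔ 1 ≤ a.natAbs ∧ a.natAbs ≤ n := by
  rw [OmegaSet, Set.mem_ofPred_eq, Int.abs_eq_natAbs]
  omega

lemma mem_omegaSet_iff {a : ℤ} :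
    a ∈ OmegaSet n ↔ ∃ i : Fin n, a = (i : ℤ) + 1 ∨ a = -((i : ℤ) + 1) := by
  rw [mem_omegaSet_iff_natAbs]
  constructor
  · rintro ⟨h1, h2⟩
    refine ⟨⟨a.natAbs - 1, by omega⟩, ?_⟩
    simp only
    omega
  · rintro ⟨i, rfl | rfl⟩ <;> omega

lemma signedEntry_mem (i : Fin n) (s : Bool) : signedEntry i s ∈ OmegaSet n :=
  mem_omegaSet_iff.2 ⟨i, by cases s <;> simp [signedEntry]⟩

lemma signedEntry_inj {i j : Fin n} {s t : Bool} (h : signedEntry i s = signedEntry j t) :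
    i = j ∧ s = t := by
  cases s <;> cases t <;> simp [signedEntry] at h ⊢ <;> omega

lemma rlt_signedEntry {i j : Fin n} {s t : Bool} :
    rlt (signedEntry i s) (signedEntry j t) ↔ s < t ∨ s = t ∧ i < j := by
  cases s <;> cases t <;>
    simp [signedEntry, rlt, Bool.lt_iff, -Fin.val_fin_lt, Fin.lt_def] <;> omega

lemma rlt_signedEntry_zero {i : Fin n} {s : Bool} : rlt (signedEntry i s) 0 ↔ s = false := by
  cases s <;> simp [signedEntry, rlt] <;> omega

namespace InvolutionData

/-- The signed permutation with the given absolute values and signs of entries. -/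
noncomputable def toFun (p : InvolutionData n) (a : ℤ) : ℤ :=
  if h : a ∈ OmegaSet n then
    have hi : a.natAbs - 1 < n := by have := mem_omegaSet_iff_natAbs.1 h; omega
    a.sign * signedEntry (p.1.1 ⟨a.natAbs - 1, hi⟩) (p.1.2 ⟨a.natAbs - 1, hi⟩)
  else a

lemma toFun_succ (p : InvolutionData n) (i : Fin n) :
    p.toFun ((i : ℤ) + 1) = signedEntry (p.1.1 i) (p.1.2 i) := by
  have hi : (⟨((i : ℤ) + 1).natAbs - 1, by omega⟩ : Fin n) = i := Fin.ext (by simp only; omega)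
  have hs : ((i : ℤ) + 1).sign = 1 := Int.sign_eq_one_of_pos (by omega)
  rw [toFun, dif_pos (mem_omegaSet_iff.2 ⟨i, .inl rfl⟩)]
  simp only [hi, hs, one_mul]

lemma toFun_of_notMem (p : InvolutionData n) {a : ℤ} (h : a ∉ OmegaSet n) : p.toFun a = a :=
  dif_neg h

lemma toFun_neg (p : InvolutionData n) (a : ℤ) : p.toFun (-a) = -p.toFun a := by
  have hiff : -a ∈ OmegaSet n ↔ a ∈ OmegaSet n := by simp [OmegaSet]
  by_cases h : a ∈ OmegaSet n
  · rw [toFun, toFun, dif_pos h, dif_pos (hiff.2 h)]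
    simp only [Int.natAbs_neg, Int.sign_neg, neg_mul]
  · rw [toFun_of_notMem p h, toFun_of_notMem p (mt hiff.1 h)]

lemma toFun_signedEntry (p : InvolutionData n) (i : Fin n) (s : Bool) :
    p.toFun (signedEntry i s) = signedEntry (p.1.1 i) (if s then p.1.2 i else !p.1.2 i) := by
  have hneg (s : Bool) (i : Fin n) : -signedEntry i s = signedEntry i (!s) := by
    cases s <;> simp [signedEntry]
  cases s
  · rw [← Bool.not_true, ← hneg, toFun_neg, signedEntry, if_pos rfl, toFun_succ, hneg]
    simp
  · rw [signedEntry, if_pos rfl, toFun_succ]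
    simp

lemma exists_signedEntry {a : ℤ} (h : a ∈ OmegaSet n) : ∃ i s, a = signedEntry (n := n) i s := by
  obtain ⟨i, rfl | rfl⟩ := mem_omegaSet_iff.1 h
  exacts [⟨i, true, rfl⟩, ⟨i, false, rfl⟩]

lemma toFun_toFun (p : InvolutionData n) (a : ℤ) : p.toFun (p.toFun a) = a := by
  by_cases h : a ∈ OmegaSet n
  · obtain ⟨i, s, rfl⟩ := exists_signedEntry h
    rw [toFun_signedEntry, toFun_signedEntry, p.2.1, p.2.2]
    cases s <;> cases p.1.2 i <;> rfl
  · rw [toFun_of_notMem p h, toFun_of_notMem p h]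

lemma isSignedInvolution_toFun (p : InvolutionData n) : IsSignedInvolution n p.toFun := by
  have hmaps : Set.MapsTo p.toFun (OmegaSet n) (OmegaSet n) := fun a h => by
    obtain ⟨i, s, rfl⟩ := exists_signedEntry h
    rw [toFun_signedEntry]
    exact signedEntry_mem _ _
  have hinv : Set.InvOn p.toFun p.toFun (OmegaSet n) (OmegaSet n) :=
    ⟨fun a _ => p.toFun_toFun a, fun a _ => p.toFun_toFun a⟩
  exact ⟨⟨p.toFun_neg, hinv.bijOn hmaps hmaps, fun a => p.toFun_of_notMem⟩, p.toFun_toFun⟩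

lemma toFun_injective : Function.Injective (toFun (n := n)) := by
  intro p q h
  have h' (i : Fin n) : p.1.1 i = q.1.1 i ∧ p.1.2 i = q.1.2 i := signedEntry_inj <| by
    rw [← toFun_succ, h, toFun_succ]
  exact Subtype.ext (Prod.ext (Equiv.ext fun i => (h' i).1) (funext fun i => (h' i).2))

lemma exists_toFun_eq {w : ℤ → ℤ} (hw : IsSignedInvolution n w) :
    ∃ p : InvolutionData n, p.toFun = w := by
  obtain ⟨⟨hodd, hbij, hid⟩, hinv⟩ := hw
  have hex (i : Fin n) : ∃ j s, w ((i : ℤ) + 1) = signedEntry (n := n) j s :=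
    exists_signedEntry (hbij.mapsTo (mem_omegaSet_iff.2 ⟨i, .inl rfl⟩))
  choose σ ε hσε using hex
  have hσ (i : Fin n) : σ (σ i) = i ∧ ε (σ i) = ε i := by
    apply signedEntry_inj
    rw [← hσε]
    have h := congrArg w (hσε i)
    rw [hinv] at h
    cases hε : ε i
    · rw [hε, signedEntry, if_neg (by simp), hodd] at h
      simp only [signedEntry, Bool.false_eq_true, if_false]
      omega
    · rw [hε, signedEntry, if_pos rfl] at h
      rw [← h]
      rfl
  let p : InvolutionData n :=
    ⟨(Function.Involutive.toPerm σ fun i => (hσ i).1, ε), fun i => (hσ i).1, fun i => (hσ i).2⟩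
  have hp (i : Fin n) : p.toFun ((i : ℤ) + 1) = w ((i : ℤ) + 1) := by
    rw [toFun_succ, hσε]
    rfl
  refine ⟨p, funext fun a => ?_⟩
  by_cases h : a ∈ OmegaSet n
  · obtain ⟨i, rfl | rfl⟩ := mem_omegaSet_iff.1 h
    · exact hp i
    · rw [toFun_neg, hodd, hp]
  · rw [hid a h, toFun_of_notMem p h]

lemma range_toFun : Set.range (toFun (n := n)) = {w | IsSignedInvolution n w} :=
  Set.ext fun _ => ⟨fun ⟨p, hp⟩ => hp ▸ p.isSignedInvolution_toFun, exists_toFun_eq⟩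

lemma card_isLabelling (p : InvolutionData n) :
    Nat.card {f : Fin n → Fin (m + 1) // p.IsLabelling f} =
      (n + m - desB n p.toFun).choose n := by
  let D : ℕ → Prop := fun i => rlt (p.toFun ((i : ℤ) + 1)) (p.toFun (i : ℤ))
  have hdes : desB n p.toFun = Nat.count D n := (Nat.count_eq_card_filter_range D n).symm
  rw [hdes, ← card_isCompatible n m D]
  refine Nat.card_congr (Equiv.subtypeEquivRight fun f => Iff.symm ?_)
  refine isCompatible_iff (D := D) (P := fun h => p.1.2 ⟨0, h⟩ = false) p.key_injective
    (fun hn => ?_) (fun i h => ?_)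
  · have h0 : p.toFun 0 = 0 := p.toFun_of_notMem (by simp [OmegaSet])
    have h1 := p.toFun_succ ⟨0, hn⟩
    simp only [D, Nat.cast_zero] at h1 ⊢
    rw [h0, h1, rlt_signedEntry_zero]
  · have h1 := p.toFun_succ ⟨i, by omega⟩
    have h2 := p.toFun_succ ⟨i + 1, h⟩
    simp only [D]
    push_cast at h1 h2 ⊢
    rw [h1, h2, rlt_signedEntry, key_lt_iff]

end InvolutionData

end SignedInvolutions

/-- Theorem 1.1, coefficient form: for all `n, m ≥ 0`,
`∑_{w ∈ I_n^B} C(n + m - des_B(w), n)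
  = ∑_{j=0}^{⌊n/2⌋} C(m² + j - 1, j) ⬝ C(2m + n - 2j, n - 2j)`.
(The sum on the left is a finite sum, over the finite set of involutions in `B_n`;
note that `des_B(w) ≤ n`, and for `m = 0, j = 0` the truncated subtraction gives
`C(m² + j - 1, j) = C(0,0) = 1`, the correct value of the multiset coefficient.) -/
theorem genfun_InB_coeff (n m : ℕ) :
    (∑ᶠ w ∈ {w : ℤ → ℤ | IsSignedInvolution n w}, Nat.choose (n + m - desB n w) n) =
      ∑ j ∈ Finset.range (n / 2 + 1),
        Nat.choose (m ^ 2 + j - 1) j * Nat.choose (2 * m + n - 2 * j) (n - 2 * j) := by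
  rw [← InvolutionData.range_toFun, finsum_mem_range InvolutionData.toFun_injective,
    finsum_eq_sum_of_fintype]
  simp_rw [← InvolutionData.card_isLabelling]
  rw [← Nat.card_sigma, InvolutionData.card_labelled,
    card_invariant_sym Biletter.swap_involutive]
  refine Finset.sum_congr rfl fun j hj => ?_
  have hj' : j < n / 2 + 1 := Finset.mem_range.1 hj
  rw [Biletter.card_lt_swap, Biletter.card_swap_eq, Nat.multichoose_eq, Nat.multichoose_eq]
  congr 2
  omega
end

section
/- (Equation (1), coefficient form) For all integers n ≥ 0 and m ≥ 0, ∑_{w ∈ I_n} C(n + m − des(w), n) = ∑_{j=0}^{⌊n/2⌋} C(m(m+1)/2 + j − 1, j) · C(m + n − 2j, n − 2j), where C(a,b) denotes the binomial coefficient, equal to 0 when a < b. -/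
open scoped Classical

/-- The number of descents of a permutation `w` of `{1,…,n}` (represented on `Fin n`):
`des(w) = #{ i ∈ {1,…,n-1} : w(i) > w(i+1) }`. -/
noncomputable def desS (n : ℕ) (w : Equiv.Perm (Fin n)) : ℕ :=
  ((Finset.range n).filter fun i : ℕ =>
    ∃ h : i + 1 < n, w ⟨i, Nat.lt_of_succ_lt h⟩ > w ⟨i + 1, h⟩).card

/-- The set of involutions in the symmetric group `S_n`. -/
noncomputable def InvolutionsS (n : ℕ) : Finset (Equiv.Perm (Fin n)) :=
  Finset.univ.filter fun w : Equiv.Perm (Fin n) => w * w = 1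

open Finset Equiv

theorem Fin.strictMono_iff_lt_next {β : Type*} [Preorder β] {n : ℕ} {f : Fin n → β} :
    StrictMono f ↔
      ∀ (i : ℕ) (h : i + 1 < n), f ⟨i, Nat.lt_of_succ_lt h⟩ < f ⟨i + 1, h⟩ := by
  cases n with
  | zero => exact ⟨fun _ i h => absurd h (by omega), fun _ i => i.elim0⟩
  | succ n =>
    rw [Fin.strictMono_iff_lt_succ]
    exact ⟨fun h i hi => h ⟨i, by omega⟩, fun h i => h i (by omega)⟩

theorem Fin.monotone_iff_le_next {β : Type*} [Preorder β] {n : ℕ} {f : Fin n → β} :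
    Monotone f ↔
      ∀ (i : ℕ) (h : i + 1 < n), f ⟨i, Nat.lt_of_succ_lt h⟩ ≤ f ⟨i + 1, h⟩ := by
  cases n with
  | zero => exact ⟨fun _ i h => absurd h (by omega), fun _ i => i.elim0⟩
  | succ n =>
    rw [Fin.monotone_iff_le_succ]
    exact ⟨fun h i hi => h ⟨i, by omega⟩, fun h i => h i (by omega)⟩

theorem Monotone.eq_of_multiset_map_eq {β : Type*} [PartialOrder β] {n : ℕ} {f g : Fin n → β}
    (hf : Monotone f) (hg : Monotone g)
    (h : (univ : Finset (Fin n)).val.map f = (univ : Finset (Fin n)).val.map g) : f = g := by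
  rw [Fin.univ_val_map, Fin.univ_val_map, Multiset.coe_eq_coe] at h
  exact List.ofFn_injective
    (h.eq_of_pairwise' hf.sortedLE_ofFn.pairwise hg.sortedLE_ofFn.pairwise)

theorem Multiset.exists_monotone_map_univ_eq {β : Type*} [LinearOrder β] (s : Multiset β) :
    ∃ f : Fin (card s) → β, Monotone f ∧ (Finset.univ : Finset (Fin (card s))).val.map f = s := by
  have hl : (s.sort (· ≤ ·)).length = card s := Multiset.length_sort _
  refine ⟨fun i => (s.sort (· ≤ ·)).get (i.cast hl.symm), ?_, ?_⟩
  · intro i j hij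
    exact (Multiset.pairwise_sort s (· ≤ ·)).sortedLE.monotone_get hij
  · rw [Fin.univ_val_map]
    conv_rhs => rw [← Multiset.sort_eq s (· ≤ ·)]
    congr 1
    apply List.ext_get
    · simp
    · intro k h1 h2
      simp

section Involutions

variable {K : Type*} [LinearOrder K] {n : ℕ}

theorem monotone_of_strictMono_toLex {w : Perm (Fin n)} {a : Fin n → K}
    (h : StrictMono fun i => toLex (a i, w i)) : Monotone a := by
  intro i j hij
  have := h.monotone hij
  rw [Prod.Lex.toLex_le_toLex] at this
  rcases this with h | h
  · exact h.le
  · exact h.1.le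

theorem monotone_toLex_comp {w : Perm (Fin n)} {a : Fin n → K}
    (h : StrictMono fun i => toLex (a i, w i)) : Monotone fun i => toLex (a i, a (w i)) := by
  intro i j hij
  have := h.monotone hij
  rw [Prod.Lex.toLex_le_toLex] at this ⊢
  exact this.imp_right fun h' => ⟨h'.1, monotone_of_strictMono_toLex h h'.2⟩

theorem eq_sort_of_strictMono_toLex {w : Perm (Fin n)} {a : Fin n → K} (hw : w * w = 1)
    (h : StrictMono fun i => toLex (a i, w i)) : w = Tuple.sort (a ∘ w) := by
  have hww : ∀ i, w (w i) = i := fun i => by rw [← Perm.mul_apply, hw, Perm.one_apply]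
  rw [Tuple.eq_sort_iff]
  refine ⟨fun i j hij => ?_, fun i j hij he => ?_⟩
  · simpa [hww] using monotone_of_strictMono_toLex h hij
  · have := h hij
    simp only [Function.comp_apply, hww] at he
    rw [Prod.Lex.toLex_lt_toLex] at this
    exact (this.resolve_left (by simp [he])).2

/-- A lexicographically sorted sequence of pairs whose multiset is invariant under swapping is of
the form `i ↦ (x i, x (w i))`, where the involution `w` is the stable sort of second entries. -/
theorem exists_involution_of_monotone_toLex {x y : Fin n → K}
    (h : Monotone fun i => toLex (x i, y i))
    (hs : (univ : Finset (Fin n)).val.map (fun i => (y i, x i)) =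
      (univ : Finset (Fin n)).val.map fun i => (x i, y i)) :
    ∃ w : Perm (Fin n), w * w = 1 ∧ (StrictMono fun i => toLex (x i, w i)) ∧ x ∘ w = y := by
  obtain ⟨w, hw⟩ : ∃ w, w = Tuple.sort y := ⟨_, rfl⟩
  obtain ⟨hmono, htie⟩ := Tuple.eq_sort_iff.1 hw
  have hle : ∀ {i j}, i ≤ j → x i < x j ∨ x i = x j ∧ y i ≤ y j := fun hij => by
    have := h hij
    rwa [Prod.Lex.toLex_le_toLex] at this
  have hxmono : Monotone x := fun i j hij => (hle hij).elim le_of_lt fun h => h.1.le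
  have key : (fun i => toLex (y (w i), x (w i))) = fun i => toLex (x i, y i) := by
    refine Monotone.eq_of_multiset_map_eq (fun i j hij => ?_) h ?_
    · rw [Prod.Lex.toLex_le_toLex]
      rcases (hmono hij).lt_or_eq with hlt | heq
      · exact Or.inl hlt
      · refine Or.inr ⟨heq, hxmono ?_⟩
        rcases hij.lt_or_eq with hlt | rfl
        · exact (htie i j hlt heq).le
        · exact le_rfl
    · have h1 : (univ : Finset (Fin n)).val.map (fun i => toLex (y (w i), x (w i))) =
          (univ : Finset (Fin n)).val.map (fun i => toLex (y i, x i)) := by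
        conv_rhs => rw [← Multiset.map_univ_val_equiv w, Multiset.map_map]
        rfl
      rw [h1]
      simpa [Multiset.map_map, Function.comp_def] using congrArg (Multiset.map toLex) hs
  have hyw : ∀ i, y (w i) = x i := fun i => congrArg (fun p => (ofLex p).1) (congrFun key i)
  have hxw : ∀ i, x (w i) = y i := fun i => congrArg (fun p => (ofLex p).2) (congrFun key i)
  have hinv : w.symm = w := by
    have hyi : ∀ i, y (w.symm i) = x i := fun i => by rw [← hxw, apply_symm_apply]
    nth_rewrite 2 [hw]
    rw [Tuple.eq_sort_iff]
    refine ⟨fun i j hij => by simpa [hyi] using hxmono hij, fun i j hij he => ?_⟩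
    rw [hyi, hyi] at he
    obtain ⟨p, rfl⟩ := w.surjective i
    obtain ⟨q, rfl⟩ := w.surjective j
    simp only [symm_apply_apply]
    by_contra! hqp
    have hne : q ≠ p := fun e => hij.ne (by rw [e])
    have hy : y (w p) ≤ y (w q) := ((hle hij.le).resolve_left he.not_lt).2
    have hx : x q = x p := le_antisymm (hxmono hqp) (by rwa [← hyw, ← hyw q])
    exact absurd (htie q p (lt_of_le_of_ne hqp hne) (by rw [hyw, hyw, hx])) hij.not_gt
  refine ⟨w, Equiv.ext fun i => ?_, fun i j hij => ?_, funext hxw⟩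
  · rw [Perm.mul_apply, Perm.one_apply]
    nth_rewrite 1 [← hinv]
    exact w.symm_apply_apply i
  · rw [Prod.Lex.toLex_lt_toLex]
    rcases (hxmono hij.le).lt_or_eq with h' | h'
    · exact Or.inl h'
    · exact Or.inr ⟨h', htie i j hij (by rw [hyw, hyw, h'])⟩

theorem card_involution_labelings_eq_card_swap_invariant [Fintype K] :
    #{p : Perm (Fin n) × (Fin n → K) |
        p.1 * p.1 = 1 ∧ StrictMono fun i => toLex (p.2 i, p.1 i)} =
      #{s : Sym (K × K) n | (s : Multiset (K × K)).map Prod.swap = s} := by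
  refine card_bij (fun p _ => ⟨(univ : Finset (Fin n)).val.map fun i => (p.2 i, p.2 (p.1 i)),
    by simp⟩) ?_ ?_ ?_
  · rintro ⟨w, a⟩ hp
    obtain ⟨hw, -⟩ := (mem_filter.1 hp).2
    have hww : ∀ i, w (w i) = i := fun i => by
      have := congrArg (fun σ : Perm (Fin n) => σ i) hw
      simpa using this
    refine mem_filter.2 ⟨mem_univ _, ?_⟩
    simp only [Sym.coe_mk, Multiset.map_map]
    conv_rhs => rw [← Multiset.map_univ_val_equiv w, Multiset.map_map]
    refine Multiset.map_congr rfl fun i _ => ?_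
    simp [hww]
  · rintro ⟨w, a⟩ hp ⟨w', a'⟩ hp' heq
    obtain ⟨hw, ha⟩ := (mem_filter.1 hp).2
    obtain ⟨hw', ha'⟩ := (mem_filter.1 hp').2
    have hm := congrArg (fun s : Sym (K × K) n => (s : Multiset (K × K)).map toLex) heq
    simp only [Sym.coe_mk, Multiset.map_map] at hm
    have hf := Monotone.eq_of_multiset_map_eq (monotone_toLex_comp ha) (monotone_toLex_comp ha') hm
    have h1 : a = a' := funext fun i => congrArg (fun p => (ofLex p).1) (congrFun hf i)
    have h2 : a ∘ w = a' ∘ w' := funext fun i => congrArg (fun p => (ofLex p).2) (congrFun hf i)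
    have h3 : w = w' := by
      rw [show w = _ from eq_sort_of_strictMono_toLex hw ha,
        show w' = _ from eq_sort_of_strictMono_toLex hw' ha']
      exact congrArg Tuple.sort h2
    rw [h1, h3]
  · rintro ⟨s, rfl⟩ hs
    replace hs : s.map Prod.swap = s := (mem_filter.1 hs).2
    obtain ⟨f, hf, hfs⟩ := Multiset.exists_monotone_map_univ_eq (s.map toLex)
    have hc : Multiset.card (s.map toLex) = Multiset.card s := Multiset.card_map _ _
    generalize Multiset.card (s.map toLex) = N at f hf hfs hc
    subst hc
    have hfs' : (univ : Finset (Fin _)).val.map (fun i => ((ofLex (f i)).1, (ofLex (f i)).2)) = s := by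
      have := congrArg (Multiset.map ofLex) hfs
      simpa [Multiset.map_map, Function.comp_def] using this
    obtain ⟨w, hw, hm, hx⟩ := exists_involution_of_monotone_toLex
      (x := fun i => (ofLex (f i)).1) (y := fun i => (ofLex (f i)).2) hf (by
        rw [hfs']
        conv_rhs => rw [← hs, ← hfs', Multiset.map_map]
        rfl)
    refine ⟨(w, fun i => (ofLex (f i)).1), mem_filter.2 ⟨mem_univ _, hw, hm⟩, Subtype.ext ?_⟩
    refine Eq.trans ?_ hfs'
    refine Multiset.map_congr (s := (univ : Finset (Fin _)).val) rfl fun i _ => ?_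
    exact congrArg (Prod.mk _) (congrFun hx i)

end Involutions

section SwapInvariant

variable {K : Type*} [LinearOrder K]

theorem Multiset.filter_fst_lt_snd_symmetrization (u : Multiset {p : K × K // p.1 < p.2})
    (t : Multiset K) :
    (u.map Subtype.val + u.map (fun p => p.1.swap) + t.map fun x => (x, x)).filter
      (fun p => p.1 < p.2) = u.map Subtype.val := by
  simp only [Multiset.filter_add, Multiset.filter_map]
  rw [Multiset.filter_eq_self.2 (fun p _ => p.2),
    Multiset.filter_eq_nil.2 (fun p _ => p.2.not_gt), Multiset.filter_eq_nil.2 (by simp)]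
  simp

theorem Multiset.filter_fst_eq_snd_symmetrization (u : Multiset {p : K × K // p.1 < p.2})
    (t : Multiset K) :
    (u.map Subtype.val + u.map (fun p => p.1.swap) + t.map fun x => (x, x)).filter
      (fun p => p.1 = p.2) = t.map fun x => (x, x) := by
  simp only [Multiset.filter_add, Multiset.filter_map]
  rw [Multiset.filter_eq_nil.2 (fun p _ => p.2.ne),
    Multiset.filter_eq_nil.2 (fun p _ => p.2.ne'), Multiset.filter_eq_self.2 (by simp)]
  simp

theorem Multiset.exists_symmetrization_eq {s : Multiset (K × K)} (hs : s.map Prod.swap = s) :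
    ∃ (u : Multiset {p : K × K // p.1 < p.2}) (t : Multiset K),
      u.map Subtype.val + u.map (fun p => p.1.swap) + t.map (fun x => (x, x)) = s := by
  obtain ⟨u, hu⟩ := CanLift.prf (β := Multiset {p : K × K // p.1 < p.2})
    (s.filter fun p => p.1 < p.2) (fun p hp => (Multiset.mem_filter.1 hp).2)
  replace hu : u.map Subtype.val = s.filter fun p => p.1 < p.2 := hu
  refine ⟨u, (s.filter fun p => p.1 = p.2).map Prod.fst, ?_⟩
  have h1 : u.map (fun p => p.1.swap) = s.filter fun p => p.2 < p.1 := by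
    have : u.map (fun p => p.1.swap) = (u.map Subtype.val).map Prod.swap := by
      rw [Multiset.map_map]; rfl
    rw [this, hu]
    conv_rhs => rw [← hs, Multiset.filter_map]
    rfl
  have h2 : ((s.filter fun p => p.1 = p.2).map Prod.fst).map (fun x => (x, x)) =
      s.filter fun p => p.1 = p.2 := by
    rw [Multiset.map_map]
    conv_rhs => rw [← Multiset.map_id (s.filter fun p => p.1 = p.2)]
    refine Multiset.map_congr rfl fun p hp => ?_
    have := (Multiset.mem_filter.1 hp).2
    ext <;> simp [this]
  rw [hu, h1, h2]
  ext p
  simp only [Multiset.count_add, Multiset.count_filter]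
  rcases lt_trichotomy p.1 p.2 with h | h | h
  · simp [h, h.not_gt, h.ne]
  · simp [h]
  · simp [h, h.not_gt, h.ne']

theorem card_swap_invariant_of_card_filter_eq [Fintype K] {n j : ℕ} (hj : 2 * j ≤ n) :
    #{s : Sym (K × K) n | (s : Multiset (K × K)).map Prod.swap = s ∧
        Multiset.card ((s : Multiset (K × K)).filter fun p => p.1 < p.2) = j} =
      Fintype.card (Sym {p : K × K // p.1 < p.2} j) * Fintype.card (Sym K (n - 2 * j)) := by
  rw [← Fintype.card_prod, ← card_univ]
  symm
  refine card_bij (fun q _ => ⟨(q.1 : Multiset {p : K × K // p.1 < p.2}).map Subtype.val +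
    (q.1 : Multiset {p : K × K // p.1 < p.2}).map (fun p => p.1.swap) +
      (q.2 : Multiset K).map fun x => (x, x), ?_⟩)
    ?_ ?_ ?_
  · simp only [Multiset.card_add, Multiset.card_map, Sym.card_coe]
    omega
  · rintro ⟨u, t⟩ -
    refine mem_filter.2 ⟨mem_univ _, ?_, ?_⟩
    · simp only [Sym.coe_mk, Multiset.map_add, Multiset.map_map, Function.comp_def, Prod.swap_swap,
        Prod.swap_prod_mk]
      rw [add_comm (Multiset.map _ _) (Multiset.map _ _)]
    · simp only [Sym.coe_mk]
      rw [Multiset.filter_fst_lt_snd_symmetrization]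
      simp
  · rintro ⟨u, t⟩ - ⟨u', t'⟩ - h
    replace h := congrArg (Subtype.val) h
    have h1 := congrArg (Multiset.filter fun p : K × K => p.1 < p.2) h
    have h2 := congrArg (Multiset.filter fun p : K × K => p.1 = p.2) h
    simp only [Multiset.filter_fst_lt_snd_symmetrization,
      Multiset.filter_fst_eq_snd_symmetrization] at h1 h2
    rw [Prod.mk.injEq]
    exact ⟨Sym.coe_injective (Multiset.map_injective Subtype.val_injective h1),
      Sym.coe_injective (Multiset.map_injective (fun x y h => congrArg Prod.fst h) h2)⟩
  · rintro ⟨s, hn⟩ hs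
    obtain ⟨hs, hc⟩ := (mem_filter.1 hs).2
    simp only [Sym.coe_mk] at hs hc
    obtain ⟨u, t, rfl⟩ := Multiset.exists_symmetrization_eq hs
    rw [Multiset.filter_fst_lt_snd_symmetrization, Multiset.card_map] at hc
    simp only [Multiset.card_add, Multiset.card_map] at hn
    exact ⟨(⟨u, hc⟩, ⟨t, by omega⟩), mem_univ _, rfl⟩

theorem card_swap_invariant [Fintype K] (n : ℕ) :
    #{s : Sym (K × K) n | (s : Multiset (K × K)).map Prod.swap = s} =
      ∑ j ∈ range (n / 2 + 1),
        Fintype.card (Sym {p : K × K // p.1 < p.2} j) * Fintype.card (Sym K (n - 2 * j)) := by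
  have hmaps : Set.MapsTo
      (fun s : Sym (K × K) n => Multiset.card ((s : Multiset (K × K)).filter fun p => p.1 < p.2))
      ({s : Sym (K × K) n | (s : Multiset (K × K)).map Prod.swap = s} : Finset _)
      (range (n / 2 + 1)) := by
    rintro ⟨s, hn⟩ hs
    replace hs : s.map Prod.swap = s := (mem_filter.1 hs).2
    obtain ⟨u, t, rfl⟩ := Multiset.exists_symmetrization_eq hs
    simp only [Multiset.card_add, Multiset.card_map] at hn
    simp only [Sym.coe_mk, Multiset.filter_fst_lt_snd_symmetrization, Multiset.card_map,
      coe_range, Set.mem_Iio]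
    omega
  rw [card_eq_sum_card_fiberwise hmaps]
  refine sum_congr rfl fun j hj => ?_
  rw [filter_filter, card_swap_invariant_of_card_filter_eq]
  have := mem_range.1 hj
  omega

end SwapInvariant

theorem Fin.card_fst_lt_snd (n : ℕ) :
    Fintype.card {p : Fin n × Fin n // p.1 < p.2} = n * (n - 1) / 2 := by
  rw [Fintype.card_subtype, card_filter, Fintype.sum_prod_type_right, ← Finset.sum_range_id,
    Finset.sum_range]
  refine sum_congr rfl fun y _ => ?_
  rw [← card_filter, show ({x | x < y} : Finset (Fin n)) = Iio y by ext; simp, Fin.card_Iio]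

theorem card_labelings_eq_choose {n m : ℕ} (w : Perm (Fin n)) :
    #{a : Fin n → Fin (m + 1) | StrictMono fun i => toLex (a i, w i)} =
      (n + m - desS n w).choose n := by
  set D : ℕ → Prop := fun i =>
    ∃ h : i + 1 < n, w ⟨i, Nat.lt_of_succ_lt h⟩ > w ⟨i + 1, h⟩ with hD
  set e : ℕ → ℕ := fun i => #{k ∈ range i | ¬ D k} with he
  have he_succ : ∀ i, e (i + 1) = e i + if D i then 0 else 1 := fun i => by
    simp only [he, range_add_one, filter_insert]
    split_ifs with h <;> simp
  have he_le : ∀ i, e i ≤ i := fun i => (card_filter_le _ _).trans (card_range i).le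
  have he_add : ∀ i, e i + #{k ∈ range i | D k} = i := fun i => by
    rw [add_comm, he]
    exact (card_filter_add_card_filter_not D).trans (card_range i)
  have hdes : 0 < n → e (n - 1) + desS n w + 1 = n := fun hn => by
    obtain ⟨k, rfl⟩ : ∃ k, n = k + 1 := ⟨n - 1, by omega⟩
    have h1 := he_add (k + 1)
    have h2 := he_succ k
    have h3 : ¬ D k := fun h => absurd h.1 (by omega)
    have h4 : desS (k + 1) w = #{i ∈ range (k + 1) | D i} := rfl
    simp only [h3, if_false] at h2
    simp only [Nat.add_sub_cancel]
    omega
  have hiff : ∀ a : Fin n → ℕ, (StrictMono fun i => toLex (a i, w i)) ↔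
      StrictMono fun i => a i + e i := fun a => by
    rw [Fin.strictMono_iff_lt_next, Fin.strictMono_iff_lt_next]
    refine forall₂_congr fun i h => ?_
    rw [Prod.Lex.toLex_lt_toLex]
    simp only [he_succ]
    have hne : w ⟨i, Nat.lt_of_succ_lt h⟩ ≠ w ⟨i + 1, h⟩ := fun hw => by
      simpa using w.injective hw
    by_cases hd : D i
    · have hlt := hd.2
      simp only [hd, if_true, hlt.not_gt, and_false, or_false]
      omega
    · have hlt : w ⟨i, Nat.lt_of_succ_lt h⟩ < w ⟨i + 1, h⟩ :=
        lt_of_le_of_ne (not_lt.1 fun h' => hd ⟨h, h'⟩) hne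
      simp only [hd, if_false, hlt, and_true]
      omega
  have hval : ∀ a : Fin n → Fin (m + 1), (StrictMono fun i => toLex (a i, w i)) ↔
      StrictMono fun i => (a i : ℕ) + e i := fun a => by
    rw [← hiff fun i => (a i : ℕ)]
    simp only [StrictMono, Prod.Lex.toLex_lt_toLex, Fin.lt_def, Fin.ext_iff]
  rw [← card_range (n + m - desS n w), ← card_powersetCard]
  refine card_bij (fun a _ => univ.image fun i => (a i : ℕ) + e i) ?_ ?_ ?_
  · intro a ha
    have hs := (hval a).1 (mem_filter.1 ha).2
    refine mem_powersetCard.2 ⟨fun x hx => ?_, by simp [card_image_of_injective _ hs.injective]⟩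
    obtain ⟨i, -, rfl⟩ := mem_image.1 hx
    have hn : 0 < n := i.pos
    have h1 := hs.monotone (show i ≤ ⟨n - 1, by omega⟩ from Fin.mk_le_mk.2 (by omega))
    have h2 := (a ⟨n - 1, by omega⟩).2
    have h3 := hdes hn
    simp only at h1
    rw [mem_range]
    omega
  · intro a ha b hb hab
    have hsa := (hval a).1 (mem_filter.1 ha).2
    have hsb := (hval b).1 (mem_filter.1 hb).2
    have := (hsa.range_inj hsb).1 (by simpa using congrArg (fun s : Finset ℕ => (s : Set ℕ)) hab)
    funext i
    have := congrFun this i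
    ext
    omega
  · intro s hs
    obtain ⟨hsub, hcard⟩ := mem_powersetCard.1 hs
    set c := s.orderEmbOfFin hcard with hc
    have hlt : ∀ i, c i < n + m - desS n w := fun i =>
      mem_range.1 (hsub (s.orderEmbOfFin_mem hcard i))
    have hge : ∀ i : Fin n, e i ≤ c i := by
      rintro ⟨i, hi⟩
      refine (he_le i).trans ?_
      induction i with
      | zero => exact Nat.zero_le _
      | succ i ih =>
        exact (ih (by omega)).trans_lt (c.strictMono (Fin.mk_lt_mk.2 i.lt_succ_self))
    have hmono : Monotone fun i => c i - e i := by
      refine Fin.monotone_iff_le_next.2 fun i h => ?_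
      have h1 : c ⟨i, Nat.lt_of_succ_lt h⟩ < c ⟨i + 1, h⟩ :=
        c.strictMono (Fin.mk_lt_mk.2 i.lt_succ_self)
      have h2 := he_succ i
      simp only
      split_ifs at h2 <;> omega
    have hle : ∀ i : Fin n, c i - e i < m + 1 := fun i => by
      have hn : 0 < n := i.pos
      have h1 := hmono (show i ≤ ⟨n - 1, by omega⟩ from Fin.mk_le_mk.2 (by omega))
      have h2 := hlt ⟨n - 1, by omega⟩
      have h3 := hdes hn
      simp only at h1
      omega
    have hce : (fun i => c i - e i + e i) = c := funext fun i => Nat.sub_add_cancel (hge i)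
    refine ⟨fun i => ⟨c i - e i, hle i⟩, mem_filter.2 ⟨mem_univ _, (hval _).2 ?_⟩, ?_⟩
    · simp only [hce]
      exact c.strictMono
    · simp only [hce]
      exact s.image_orderEmbOfFin_univ hcard

/-- Equation (1), coefficient form: for all `n, m ≥ 0`,
`∑_{w ∈ I_n} C(n + m - des(w), n)
  = ∑_{j=0}^{⌊n/2⌋} C(m(m+1)/2 + j - 1, j) ⬝ C(m + n - 2j, n - 2j)`.
(Note that `des(w) ≤ n`, and for `m = 0, j = 0` the truncated subtraction gives
`C(m(m+1)/2 + j - 1, j) = C(0,0) = 1`, the correct value of the multiset coefficient.) -/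
theorem genfun_In_coeff (n m : ℕ) :
    (∑ w ∈ InvolutionsS n, Nat.choose (n + m - desS n w) n) =
      ∑ j ∈ Finset.range (n / 2 + 1),
        Nat.choose (m * (m + 1) / 2 + j - 1) j * Nat.choose (m + n - 2 * j) (n - 2 * j) := by
  have h := card_involution_labelings_eq_card_swap_invariant (K := Fin (m + 1)) (n := n)
  rw [card_swap_invariant] at h
  calc
    _ = #{p : Perm (Fin n) × (Fin n → Fin (m + 1)) |
        p.1 * p.1 = 1 ∧ StrictMono fun i => toLex (p.2 i, p.1 i)} := by
      rw [card_filter, Fintype.sum_prod_type, InvolutionsS, sum_filter]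
      refine sum_congr rfl fun w _ => ?_
      split_ifs with hw
      · simp [hw, ← card_labelings_eq_choose]
      · simp [hw]
    _ = _ := h
    _ = _ := by
      refine sum_congr rfl fun j hj => ?_
      have := mem_range.1 hj
      rw [Sym.card_sym_eq_choose, Sym.card_sym_eq_choose, Fin.card_fst_lt_snd, Fintype.card_fin,
        Nat.add_sub_cancel, mul_comm (m + 1) m,
        show m + 1 + (n - 2 * j) - 1 = m + n - 2 * j by omega]
end

section
/- (Proposition 2.4) The polynomial I_n^B(x) is symmetric with center of symmetry n/2; equivalently, for every n ≥ 1 and every 0 ≤ k ≤ n, the number of involutions w in B_n with des_B(w) = k equals the number of involutions w in B_n with des_B(w) = n − k. -/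
open scoped Classical

section FiberReversal

variable {n : ℕ} {L M : Type*}

/-- A permutation of `Fin n` preserves the fibers of `c` and reverses the order on each. -/
def ReversesFibers (c : Fin n → L) (ρ : Equiv.Perm (Fin n)) : Prop :=
  (∀ x, c (ρ x) = c x) ∧ ∀ x y, x < y → c x = c y → ρ y < ρ x

theorem Equiv.Perm.eq_one_of_strictMono_on_fibers (c : Fin n → L) (φ : Equiv.Perm (Fin n))
    (hc : ∀ x, c (φ x) = c x) (hm : ∀ x y, x < y → c x = c y → φ x < φ y) : φ = 1 := by
  ext x
  rw [Equiv.Perm.one_apply]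
  congr 1
  induction x using WellFoundedLT.induction with
  | ind x ih =>
    rcases lt_trichotomy (φ x) x with h | h | h
    · exact φ.injective (ih _ h)
    · exact h
    · obtain ⟨z, hz⟩ := φ.surjective x
      rcases lt_trichotomy z x with h' | h' | h'
      · exact absurd (ih z h' ▸ hz) h'.ne
      · exact h' ▸ hz
      · have := hm x z h' (by rw [← hc z, hz])
        rw [hz] at this
        exact absurd this h.asymm

theorem ReversesFibers.eq {c : Fin n → L} {c' : Fin n → M} {ρ ρ' : Equiv.Perm (Fin n)}
    (h : ReversesFibers c ρ) (h' : ReversesFibers c' ρ')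
    (hcc : ∀ x y, c x = c y ↔ c' x = c' y) : ρ = ρ' := by
  have key : ∀ x y, x < y → c x = c y → ρ'⁻¹ x > ρ'⁻¹ y := by
    intro x y hxy hc
    have hx : c' (ρ'⁻¹ x) = c' x := by simpa using (h'.1 (ρ'⁻¹ x)).symm
    have hy : c' (ρ'⁻¹ y) = c' y := by simpa using (h'.1 (ρ'⁻¹ y)).symm
    by_contra! hlt
    rcases hlt.lt_or_eq with hlt | heq
    · have := h'.2 _ _ hlt (by rw [hx, hy]; exact (hcc _ _).1 hc)
      rw [Equiv.Perm.coe_inv, Equiv.apply_symm_apply, Equiv.apply_symm_apply] at this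
      exact this.asymm hxy
    · exact hxy.ne (ρ'⁻¹.injective heq)
  have : ρ'⁻¹ * ρ = 1 := by
    apply Equiv.Perm.eq_one_of_strictMono_on_fibers c
    · intro x
      rw [Equiv.Perm.mul_apply, hcc, ← h'.1, Equiv.Perm.coe_inv, Equiv.apply_symm_apply, ← hcc, h.1]
    · intro x y hxy hc
      exact key _ _ (h.2 x y hxy hc) (by rw [h.1, h.1, hc])
  rw [← mul_one ρ', ← this, mul_inv_cancel_left]

theorem exists_reversesFibers (c : Fin n → L) : ∃ ρ, ReversesFibers c ρ := by
  let e (a : L) : {x // c x = a} ≃o {x // c x = a}ᵒᵈ :=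
    (Fintype.orderIsoFinOfCardEq _ rfl).symm.trans
      (Fintype.orderIsoFinOfCardEq _ (Fintype.card_orderDual _))
  let f (x : Fin n) : Fin n := (OrderDual.ofDual (e (c x) ⟨x, rfl⟩)).1
  have hf (x) : c (f x) = c x := (OrderDual.ofDual (e (c x) ⟨x, rfl⟩)).2
  have hfe (a : L) (x) (hx : c x = a) : f x = (OrderDual.ofDual (e a ⟨x, hx⟩)).1 := by
    subst hx; rfl
  have hlt (x y) (hxy : x < y) (hc : c x = c y) : f y < f x := by
    rw [hfe (c y) x hc]
    have : e (c y) ⟨x, hc⟩ < e (c y) ⟨y, rfl⟩ := (e (c y)).lt_iff_lt.2 hxy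
    exact this
  have hinj : Function.Injective f := by
    intro x y hxy
    have hc : c x = c y := by rw [← hf x, hxy, hf]
    rcases lt_trichotomy x y with h | h | h
    · exact absurd hxy (hlt _ _ h hc).ne'
    · exact h
    · exact absurd hxy (hlt _ _ h hc.symm).ne
  exact ⟨Equiv.ofBijective f (Finite.injective_iff_bijective.1 hinj), hf, hlt⟩

/-- The permutation reversing each fiber of `c`. -/
noncomputable def fiberRev (c : Fin n → L) : Equiv.Perm (Fin n) :=
  (exists_reversesFibers c).choose

theorem reversesFibers_fiberRev (c : Fin n → L) : ReversesFibers c (fiberRev c) :=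
  (exists_reversesFibers c).choose_spec

theorem ReversesFibers.mul_self {c : Fin n → L} {ρ : Equiv.Perm (Fin n)}
    (h : ReversesFibers c ρ) : ρ * ρ = 1 := by
  apply Equiv.Perm.eq_one_of_strictMono_on_fibers c
  · intro x
    rw [Equiv.Perm.mul_apply, h.1, h.1]
  · intro x y hxy hc
    exact h.2 _ _ (h.2 x y hxy hc) (by rw [h.1, h.1, hc])

theorem ReversesFibers.apply_apply {c : Fin n → L} {ρ : Equiv.Perm (Fin n)}
    (h : ReversesFibers c ρ) (x : Fin n) : ρ (ρ x) = x := by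
  rw [← Equiv.Perm.mul_apply, h.mul_self, Equiv.Perm.one_apply]

end FiberReversal

section BlockReversal

variable {n : ℕ}

/-- A pair `(σ, ε)` encodes a signed permutation: `σ` gives the absolute values and `ε x = true`
means that the entry at `x` is positive. -/
abbrev SignedPair (n : ℕ) := Equiv.Perm (Fin n) × (Fin n → Bool)

/-- The pair encodes a signed involution. -/
def SignedPair.IsInvol (p : SignedPair n) : Prop :=
  (∀ x, p.1 (p.1 x) = x) ∧ ∀ x, p.2 (p.1 x) = p.2 x

/-- The block and the sign of a position. -/
def SignedPair.blockSign (b : Fin n → ℕ) (p : SignedPair n) (x : Fin n) : ℕ × Bool :=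
  (b x, p.2 x)

/-- The block and the sign of a position, together with the block of its image. -/
def SignedPair.cell (b : Fin n → ℕ) (p : SignedPair n) (x : Fin n) : (ℕ × Bool) × ℕ :=
  ((b x, p.2 x), b (p.1 x))

/-- The involution exchanging the pairs that increase on all blocks with the pairs that decrease
on all blocks. -/
noncomputable def SignedPair.blockFlip (b : Fin n → ℕ) (p : SignedPair n) : SignedPair n :=
  (fiberRev (p.blockSign b) * p.1 * fiberRev (p.cell b) * fiberRev (p.blockSign b), fun x ↦ !p.2 x)

namespace SignedPair

variable (b : Fin n → ℕ) (p : SignedPair n)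

theorem block_fiberRev_blockSign (x : Fin n) : b (fiberRev (p.blockSign b) x) = b x :=
  congrArg Prod.fst ((reversesFibers_fiberRev (p.blockSign b)).1 x)

theorem sign_fiberRev_blockSign (x : Fin n) : p.2 (fiberRev (p.blockSign b) x) = p.2 x :=
  congrArg Prod.snd ((reversesFibers_fiberRev (p.blockSign b)).1 x)

theorem block_fiberRev_cell (x : Fin n) : b (fiberRev (p.cell b) x) = b x :=
  congrArg (fun t ↦ t.1.1) ((reversesFibers_fiberRev (p.cell b)).1 x)

theorem sign_fiberRev_cell (x : Fin n) : p.2 (fiberRev (p.cell b) x) = p.2 x :=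
  congrArg (fun t ↦ t.1.2) ((reversesFibers_fiberRev (p.cell b)).1 x)

theorem block_apply_fiberRev_cell (x : Fin n) : b (p.1 (fiberRev (p.cell b) x)) = b (p.1 x) :=
  congrArg Prod.snd ((reversesFibers_fiberRev (p.cell b)).1 x)

theorem blockFlip_fst_apply (x : Fin n) : (p.blockFlip b).1 x = fiberRev (p.blockSign b)
    (p.1 (fiberRev (p.cell b) (fiberRev (p.blockSign b) x))) := rfl

theorem block_blockFlip (x : Fin n) :
    b ((p.blockFlip b).1 x) = b (p.1 (fiberRev (p.blockSign b) x)) := by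
  rw [blockFlip_fst_apply, block_fiberRev_blockSign b p, block_apply_fiberRev_cell b p]

theorem fiberRev_blockSign_blockFlip :
    fiberRev ((p.blockFlip b).blockSign b) = fiberRev (p.blockSign b) := by
  refine (reversesFibers_fiberRev _).eq (reversesFibers_fiberRev _) fun x y ↦ ?_
  simp [blockSign, blockFlip]

theorem fiberRev_cell_blockFlip : fiberRev ((p.blockFlip b).cell b) =
    fiberRev (p.blockSign b) * fiberRev (p.cell b) * fiberRev (p.blockSign b) := by
  have hr := reversesFibers_fiberRev (p.blockSign b)
  have hρ := reversesFibers_fiberRev (p.cell b)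
  refine (reversesFibers_fiberRev _).eq (c' := (p.blockFlip b).cell b) ⟨fun x ↦ ?_, ?_⟩
    fun x y ↦ Iff.rfl
  · simp only [cell, block_blockFlip, Equiv.Perm.mul_apply, hr.apply_apply,
      block_apply_fiberRev_cell, block_fiberRev_blockSign, block_fiberRev_cell]
    simp [blockFlip, sign_fiberRev_blockSign, sign_fiberRev_cell]
  · intro x y hxy hc
    simp only [cell, block_blockFlip, Prod.mk.injEq] at hc
    obtain ⟨⟨h1, h2⟩, h3⟩ := hc
    replace h2 : p.2 x = p.2 y := by simpa [blockFlip] using h2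
    simp only [Equiv.Perm.mul_apply]
    apply hr.2
    · apply hρ.2
      · exact hr.2 _ _ hxy (by simp [blockSign, h1, h2])
      · simp [cell, block_fiberRev_blockSign, sign_fiberRev_blockSign, h1, h2, h3]
    · simp [blockSign, block_fiberRev_blockSign, sign_fiberRev_blockSign, block_fiberRev_cell,
        sign_fiberRev_cell, h1, h2]

theorem blockFlip_blockFlip : (p.blockFlip b).blockFlip b = p := by
  have hr := reversesFibers_fiberRev (p.blockSign b)
  have hρ := reversesFibers_fiberRev (p.cell b)
  refine Prod.ext (Equiv.ext fun x ↦ ?_) (funext fun x ↦ by simp [blockFlip])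
  rw [blockFlip_fst_apply, fiberRev_blockSign_blockFlip, fiberRev_cell_blockFlip,
    blockFlip_fst_apply]
  simp only [Equiv.Perm.mul_apply, hr.apply_apply, hρ.apply_apply]

variable {b p}

theorem IsInvol.blockFlip (hp : p.IsInvol)
    (hmono : (∀ x y, x < y → p.cell b x = p.cell b y → p.1 x < p.1 y) ∨
      ∀ x y, x < y → p.cell b x = p.cell b y → p.1 y < p.1 x) : (p.blockFlip b).IsInvol := by
  have hr := reversesFibers_fiberRev (p.blockSign b)
  have hρ := reversesFibers_fiberRev (p.cell b)
  have hcell (x y) (h : p.cell b x = p.cell b y) : p.cell b (p.1 x) = p.cell b (p.1 y) := by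
    simp only [cell, hp.1, hp.2, Prod.mk.injEq] at h ⊢
    tauto
  have hconj : p.1 * fiberRev (p.cell b) * p.1 = fiberRev (p.cell b) := by
    refine ReversesFibers.eq (c := p.cell b) (c' := p.cell b) ⟨fun x ↦ ?_, fun x y hxy hc ↦ ?_⟩ hρ
      fun x y ↦ Iff.rfl
    · simp only [Equiv.Perm.mul_apply]
      rw [hcell _ _ (hρ.1 _), hp.1]
    · simp only [Equiv.Perm.mul_apply]
      have hc' := hcell _ _ hc
      have hc'' : p.cell b (fiberRev (p.cell b) (p.1 x)) =
        p.cell b (fiberRev (p.cell b) (p.1 y)) := by rw [hρ.1, hρ.1, hc']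
      rcases hmono with hm | hm
      · exact hm _ _ (hρ.2 _ _ (hm _ _ hxy hc) hc') hc''.symm
      · exact hm _ _ (hρ.2 _ _ (hm _ _ hxy hc) hc'.symm) hc''
  have hcomm (x) : p.1 (fiberRev (p.cell b) (p.1 x)) = fiberRev (p.cell b) x := by
    conv_rhs => rw [← hconj]
    rfl
  refine ⟨fun x ↦ ?_, fun x ↦ ?_⟩
  · rw [blockFlip_fst_apply, blockFlip_fst_apply, hr.apply_apply, hcomm, hρ.apply_apply,
      hr.apply_apply]
  · rw [blockFlip_fst_apply]
    simp [SignedPair.blockFlip, sign_fiberRev_blockSign, sign_fiberRev_cell, hp.2]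

/-- The rank of an entry in the order `<_r`. -/
def key (p : SignedPair n) (x : Fin n) : Bool ×ₗ Fin n := toLex (p.2 x, p.1 x)

theorem key_lt_key {p : SignedPair n} {x y : Fin n} : p.key x < p.key y ↔
    p.2 x < p.2 y ∨ p.2 x = p.2 y ∧ p.1 x < p.1 y := Prod.Lex.toLex_lt_toLex

variable (b p) in
/-- Involutions with increasing keys on blocks, all positive on block `0`. -/
def IncOnBlocks : Prop :=
  p.IsInvol ∧ (∀ x, b x = 0 → p.2 x = true) ∧ ∀ x y, x < y → b x = b y → p.key x < p.key y

variable (b p) in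
/-- Involutions with decreasing keys on blocks, all negative on block `0`. -/
def DecOnBlocks : Prop :=
  p.IsInvol ∧ (∀ x, b x = 0 → p.2 x = false) ∧ ∀ x y, x < y → b x = b y → p.key y < p.key x

theorem IncOnBlocks.blockFlip (hb : Monotone b) (h : p.IncOnBlocks b) :
    (p.blockFlip b).DecOnBlocks b := by
  obtain ⟨hp, h0, hlt⟩ := h
  have hr := reversesFibers_fiberRev (p.blockSign b)
  have hρ := reversesFibers_fiberRev (p.cell b)
  have hm (x y) (hxy : x < y) (h1 : b x = b y) (h2 : p.2 x = p.2 y) : p.1 x < p.1 y := by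
    simpa [key_lt_key, h2] using hlt x y hxy h1
  refine ⟨hp.blockFlip (.inl fun x y hxy hc ↦ ?_), fun x hx ↦ ?_, fun x y hxy hbxy ↦ ?_⟩
  · simp only [cell, Prod.mk.injEq] at hc
    exact hm _ _ hxy hc.1.1 hc.1.2
  · simp [SignedPair.blockFlip, h0 x hx]
  · rw [key_lt_key]
    rcases key_lt_key.1 (hlt x y hxy hbxy) with hs | ⟨hs, -⟩
    · left
      simp only [SignedPair.blockFlip]
      revert hs
      cases p.2 x <;> cases p.2 y <;> decide
    · refine .inr ⟨by simp [SignedPair.blockFlip, hs], ?_⟩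
      have hrlt := hr.2 x y hxy (by simp [blockSign, hbxy, hs])
      have hlt' := hm _ _ hrlt (by simp [block_fiberRev_blockSign, hbxy])
        (by simp [sign_fiberRev_blockSign, hs])
      rcases (hb hlt'.le).lt_or_eq with hlt'' | heq
      · apply hb.reflect_lt
        rwa [block_blockFlip b p, block_blockFlip b p]
      · have hc : p.cell b (fiberRev (p.blockSign b) y) =
            p.cell b (fiberRev (p.blockSign b) x) := by
          simp [cell, block_fiberRev_blockSign, sign_fiberRev_blockSign, hbxy, hs, heq]
        rw [blockFlip_fst_apply, blockFlip_fst_apply]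
        apply hr.2
        · apply hm _ _ (hρ.2 _ _ hrlt hc)
          · simp [block_fiberRev_cell, block_fiberRev_blockSign, hbxy]
          · simp [sign_fiberRev_cell, sign_fiberRev_blockSign, hs]
        · simp [blockSign, block_apply_fiberRev_cell, heq, hp.2, sign_fiberRev_cell,
            sign_fiberRev_blockSign, hs]

theorem DecOnBlocks.blockFlip (hb : Monotone b) (h : p.DecOnBlocks b) :
    (p.blockFlip b).IncOnBlocks b := by
  obtain ⟨hp, h0, hlt⟩ := h
  have hr := reversesFibers_fiberRev (p.blockSign b)
  have hρ := reversesFibers_fiberRev (p.cell b)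
  have hm (x y) (hxy : x < y) (h1 : b x = b y) (h2 : p.2 x = p.2 y) : p.1 y < p.1 x := by
    simpa [key_lt_key, h2] using hlt x y hxy h1
  refine ⟨hp.blockFlip (.inr fun x y hxy hc ↦ ?_), fun x hx ↦ ?_, fun x y hxy hbxy ↦ ?_⟩
  · simp only [cell, Prod.mk.injEq] at hc
    exact hm _ _ hxy hc.1.1 hc.1.2
  · simp [SignedPair.blockFlip, h0 x hx]
  · rw [key_lt_key]
    rcases key_lt_key.1 (hlt x y hxy hbxy) with hs | ⟨hs, -⟩
    · left
      simp only [SignedPair.blockFlip]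
      revert hs
      cases p.2 x <;> cases p.2 y <;> decide
    · refine .inr ⟨by simp [SignedPair.blockFlip, hs], ?_⟩
      have hrlt := hr.2 x y hxy (by simp [blockSign, hbxy, hs])
      have hlt' := hm _ _ hrlt (by simp [block_fiberRev_blockSign, hbxy])
        (by simp [sign_fiberRev_blockSign, hs])
      rcases (hb hlt'.le).lt_or_eq with hlt'' | heq
      · apply hb.reflect_lt
        rwa [block_blockFlip b p, block_blockFlip b p]
      · have hc : p.cell b (fiberRev (p.blockSign b) y) =
            p.cell b (fiberRev (p.blockSign b) x) := by
          simp [cell, block_fiberRev_blockSign, sign_fiberRev_blockSign, hbxy, hs, heq]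
        rw [blockFlip_fst_apply, blockFlip_fst_apply]
        apply hr.2
        · apply hm _ _ (hρ.2 _ _ hrlt hc)
          · simp [block_fiberRev_cell, block_fiberRev_blockSign, hbxy]
          · simp [sign_fiberRev_cell, sign_fiberRev_blockSign, hs]
        · simp [blockSign, block_apply_fiberRev_cell, heq, hp.2, sign_fiberRev_cell,
            sign_fiberRev_blockSign, hs]

theorem card_incOnBlocks_eq_card_decOnBlocks (hb : Monotone b) :
    (Finset.univ.filter fun p : SignedPair n ↦ p.IncOnBlocks b).card =
      (Finset.univ.filter fun p : SignedPair n ↦ p.DecOnBlocks b).card := by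
  refine Finset.card_nbij' (SignedPair.blockFlip b) (SignedPair.blockFlip b) ?_ ?_ ?_ ?_
  · intro p hp
    simpa using IncOnBlocks.blockFlip hb (by simpa using hp)
  · intro p hp
    simpa using DecOnBlocks.blockFlip hb (by simpa using hp)
  · exact fun p _ ↦ blockFlip_blockFlip b p
  · exact fun p _ ↦ blockFlip_blockFlip b p

end SignedPair

end BlockReversal

section DescentSets

variable {n : ℕ}

namespace SignedPair

/-- The pair has a descent just before the position `j`. -/
def IsDesc (p : SignedPair n) (j : Fin n) : Prop :=
  (j.val = 0 ∧ p.2 j = false) ∨ ∃ i : Fin n, i.val + 1 = j.val ∧ p.key j < p.key i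

/-- The descent set of a pair. -/
noncomputable def desSet (p : SignedPair n) : Finset (Fin n) := Finset.univ.filter p.IsDesc

theorem mem_desSet {p : SignedPair n} {j : Fin n} : j ∈ p.desSet ↔ p.IsDesc j := by
  simp [desSet]

theorem isDesc_of_val_eq_zero {p : SignedPair n} {j : Fin n} (hj : j.val = 0) :
    p.IsDesc j ↔ p.2 j = false := by
  simp [IsDesc, hj]

theorem isDesc_of_val_add_one {p : SignedPair n} {i j : Fin n} (hij : i.val + 1 = j.val) :
    p.IsDesc j ↔ p.key j < p.key i := by
  constructor
  · rintro (⟨h, -⟩ | ⟨k, hk, h⟩)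
    · omega
    · rwa [show i = k from Fin.ext (by omega)]
  · exact fun h ↦ .inr ⟨i, hij, h⟩

theorem key_injective (p : SignedPair n) : Function.Injective p.key := by
  intro x y h
  exact p.1.injective (congrArg (fun t ↦ (ofLex t).2) h)

theorem not_isDesc_of_val_add_one {p : SignedPair n} {i j : Fin n} (hij : i.val + 1 = j.val) :
    ¬ p.IsDesc j ↔ p.key i < p.key j := by
  have hne : p.key i ≠ p.key j := fun h ↦ by
    have := p.key_injective h
    subst this
    omega
  rw [isDesc_of_val_add_one hij, not_lt]
  exact ⟨fun h ↦ h.lt_of_ne hne, le_of_lt⟩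

end SignedPair

/-- The index of the block containing `x` when a new block starts at each element of `S`. -/
def blockIndex (S : Finset (Fin n)) (x : Fin n) : ℕ := (S.filter (· ≤ x)).card

theorem blockIndex_mono (S : Finset (Fin n)) : Monotone (blockIndex S) := fun _ _ hxy ↦
  Finset.card_le_card (Finset.monotone_filter_right _ fun _ _ h ↦ h.trans hxy)

theorem blockIndex_lt_of_mem {S : Finset (Fin n)} {x y : Fin n} (hxy : x < y) (hy : y ∈ S) :
    blockIndex S x < blockIndex S y := by
  apply Finset.card_lt_card
  refine ⟨Finset.monotone_filter_right _ fun _ _ h ↦ h.trans hxy.le, fun h ↦ ?_⟩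
  have := h (Finset.mem_filter.2 ⟨hy, le_rfl⟩)
  exact absurd (Finset.mem_filter.1 this).2 hxy.not_ge

theorem blockIndex_eq_zero {S : Finset (Fin n)} {x : Fin n} :
    blockIndex S x = 0 ↔ ∀ y ≤ x, y ∉ S := by
  simp only [blockIndex, Finset.card_eq_zero, Finset.filter_eq_empty_iff]
  exact ⟨fun h y hy hS ↦ h hS hy, fun h y hS hy ↦ h y hy hS⟩

theorem blockIndex_eq_of_notMem {S : Finset (Fin n)} {x y : Fin n} (hxy : x.val + 1 = y.val)
    (hy : y ∉ S) : blockIndex S x = blockIndex S y := by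
  unfold blockIndex
  congr 1
  refine Finset.filter_congr fun s hs ↦ ?_
  have : s.val ≠ y.val := fun h ↦ hy (Fin.ext h ▸ hs)
  simp only [Fin.le_def]
  omega

theorem rel_of_blockIndex_eq {S : Finset (Fin n)} (R : Fin n → Fin n → Prop)
    (htrans : ∀ x y z, R x y → R y z → R x z)
    (hR : ∀ i j : Fin n, i.val + 1 = j.val → j ∉ S → R i j) (x y : Fin n) (hxy : x < y)
    (hb : blockIndex S x = blockIndex S y) : R x y := by
  induction y using WellFoundedLT.induction with
  | ind y ih =>
    have hy : 0 < y.val := by have := Fin.lt_def.1 hxy; omega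
    let z : Fin n := ⟨y.val - 1, by omega⟩
    have hzy : z.val + 1 = y.val := by simp only [z]; omega
    have hzlt : z < y := Fin.lt_def.2 (by omega)
    have hxz : x ≤ z := Fin.le_def.2 (by have := Fin.lt_def.1 hxy; omega)
    have hb1 := blockIndex_mono S hxz
    have hb2 := blockIndex_mono S hzlt.le
    have hR' : R z y := hR z y hzy fun hS ↦ by
      have := blockIndex_lt_of_mem hzlt hS
      omega
    rcases hxz.lt_or_eq with h | h
    · exact htrans _ _ _ (ih z hzlt h (by omega)) hR'
    · exact h ▸ hR'

namespace SignedPair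

theorem incOnBlocks_blockIndex {S : Finset (Fin n)} {p : SignedPair n} :
    p.IncOnBlocks (blockIndex S) ↔ p.IsInvol ∧ p.desSet ⊆ S := by
  refine and_congr_right fun _ ↦ ⟨fun ⟨h0, h⟩ j hj ↦ ?_, fun h ↦ ?_⟩
  · by_contra hS
    rw [mem_desSet] at hj
    rcases Nat.eq_zero_or_pos j.val with hz | hpos
    · rw [isDesc_of_val_eq_zero hz, h0] at hj
      · exact Bool.noConfusion hj
      · refine blockIndex_eq_zero.2 fun y hy ↦ ?_
        rwa [show y = j from Fin.ext (by have := Fin.le_def.1 hy; omega)]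
    · have hij : (⟨j.val - 1, by omega⟩ : Fin n).val + 1 = j.val := by simp only; omega
      exact (not_isDesc_of_val_add_one hij).2
        (h _ _ (Fin.lt_def.2 (by omega)) (blockIndex_eq_of_notMem hij hS)) hj
  · have hR := rel_of_blockIndex_eq (S := S) (fun x y ↦ p.key x < p.key y)
      (fun _ _ _ ↦ lt_trans) fun i j hij hj ↦
        (not_isDesc_of_val_add_one hij).1 fun hd ↦ hj (h (mem_desSet.2 hd))
    refine ⟨fun x hx ↦ ?_, hR⟩
    let z : Fin n := ⟨0, by have := x.2; omega⟩
    have hz : p.2 z = true := by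
      have : z ∉ S := blockIndex_eq_zero.1 hx z (Fin.le_def.2 (Nat.zero_le _))
      by_contra hf
      exact this (h (mem_desSet.2 ((isDesc_of_val_eq_zero rfl).2 (by simpa using hf))))
    have hzx : z ≤ x := Fin.le_def.2 (Nat.zero_le _)
    rcases hzx.lt_or_eq with hlt | heq
    · have := blockIndex_mono S hzx
      have := key_lt_key.1 (hR z x hlt (by omega))
      rw [hz] at this
      rcases this with h | ⟨h, -⟩
      · revert h; cases p.2 x <;> decide
      · exact h.symm
    · exact heq ▸ hz

theorem decOnBlocks_blockIndex {S : Finset (Fin n)} {p : SignedPair n} :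
    p.DecOnBlocks (blockIndex S) ↔ p.IsInvol ∧ p.desSetᶜ ⊆ S := by
  refine and_congr_right fun _ ↦ ⟨fun ⟨h0, h⟩ j hj ↦ ?_, fun h ↦ ?_⟩
  · by_contra hS
    rw [Finset.mem_compl, mem_desSet] at hj
    rcases Nat.eq_zero_or_pos j.val with hz | hpos
    · rw [isDesc_of_val_eq_zero hz, h0] at hj
      · exact hj rfl
      · refine blockIndex_eq_zero.2 fun y hy ↦ ?_
        rwa [show y = j from Fin.ext (by have := Fin.le_def.1 hy; omega)]
    · have hij : (⟨j.val - 1, by omega⟩ : Fin n).val + 1 = j.val := by simp only; omega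
      exact hj ((isDesc_of_val_add_one hij).2
        (h _ _ (Fin.lt_def.2 (by omega)) (blockIndex_eq_of_notMem hij hS)))
  · have hdesc (j) (hj : j ∉ S) : p.IsDesc j := by
      by_contra hd
      exact hj (h (by rwa [Finset.mem_compl, mem_desSet]))
    have hR := rel_of_blockIndex_eq (S := S) (fun x y ↦ p.key y < p.key x)
      (fun _ _ _ h h' ↦ lt_trans h' h) fun i j hij hj ↦
        (isDesc_of_val_add_one hij).1 (hdesc j hj)
    refine ⟨fun x hx ↦ ?_, hR⟩
    let z : Fin n := ⟨0, by have := x.2; omega⟩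
    have hz : p.2 z = false := (isDesc_of_val_eq_zero rfl).1
      (hdesc z (blockIndex_eq_zero.1 hx z (Fin.le_def.2 (Nat.zero_le _))))
    have hzx : z ≤ x := Fin.le_def.2 (Nat.zero_le _)
    rcases hzx.lt_or_eq with hlt | heq
    · have := blockIndex_mono S hzx
      have := key_lt_key.1 (hR z x hlt (by omega))
      rw [hz] at this
      rcases this with h | ⟨h, -⟩
      · revert h; cases p.2 x <;> decide
      · exact h
    · exact heq ▸ hz

end SignedPair

/-- Two set-valued statistics with the same cumulative distribution are equidistributed. -/
theorem Finset.card_filter_eq_of_card_filter_subset {α β : Type*} [DecidableEq β]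
    (A : Finset α) (D E : α → Finset β)
    (h : ∀ S, (A.filter fun a ↦ D a ⊆ S).card = (A.filter fun a ↦ E a ⊆ S).card)
    (S : Finset β) : (A.filter fun a ↦ D a = S).card = (A.filter fun a ↦ E a = S).card := by
  induction S using Finset.strongInduction with
  | H S ih =>
    have hsplit (D : α → Finset β) : (A.filter fun a ↦ D a ⊆ S).card =
        ∑ T ∈ S.ssubsets, (A.filter fun a ↦ D a = T).card + (A.filter fun a ↦ D a = S).card := by
      rw [Finset.card_eq_sum_card_fiberwise (f := D) (t := S.powerset)
        fun a ha ↦ by simpa using (Finset.mem_filter.1 ha).2]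
      have hT : ∀ T ∈ S.powerset, ((A.filter fun a ↦ D a ⊆ S).filter fun a ↦ D a = T).card =
          (A.filter fun a ↦ D a = T).card := by
        intro T hT
        rw [Finset.filter_filter]
        congr 1
        refine Finset.filter_congr fun a _ ↦ ?_
        exact ⟨And.right, fun h ↦ ⟨h ▸ Finset.mem_powerset.1 hT, h⟩⟩
      rw [Finset.sum_congr rfl hT, Finset.ssubsets,
        Finset.sum_erase_add _ _ (Finset.mem_powerset_self S)]
    have := h S
    rw [hsplit D, hsplit E, Finset.sum_congr rfl fun T hT ↦ ih T (Finset.mem_ssubsets.1 hT)] at this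
    exact Nat.add_left_cancel this

theorem SignedPair.card_filter_card_desSet (n k : ℕ) (hk : k ≤ n) :
    (Finset.univ.filter fun p : SignedPair n ↦ p.IsInvol ∧ p.desSet.card = k).card =
      (Finset.univ.filter fun p : SignedPair n ↦ p.IsInvol ∧ p.desSet.card = n - k).card := by
  have h := Finset.card_filter_eq_of_card_filter_subset
    (Finset.univ.filter fun p : SignedPair n ↦ p.IsInvol) desSet (fun p ↦ p.desSetᶜ) fun S ↦ by
      simp only [Finset.filter_filter, ← incOnBlocks_blockIndex, ← decOnBlocks_blockIndex]
      convert card_incOnBlocks_eq_card_decOnBlocks (blockIndex_mono S)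
  have hsum (D : SignedPair n → Finset (Fin n)) :
      (Finset.univ.filter fun p : SignedPair n ↦ p.IsInvol ∧ (D p).card = k).card =
      ∑ T ∈ Finset.univ.filter (fun T : Finset (Fin n) ↦ T.card = k),
        ((Finset.univ.filter fun p : SignedPair n ↦ p.IsInvol).filter fun p ↦ D p = T).card := by
    rw [Finset.card_eq_sum_card_fiberwise (f := D)
      (t := Finset.univ.filter fun T : Finset (Fin n) ↦ T.card = k)
      fun a ha ↦ by simpa using (Finset.mem_filter.1 ha).2.2]
    refine Finset.sum_congr rfl fun T hT ↦ ?_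
    rw [Finset.filter_filter, Finset.filter_filter]
    congr 1
    refine Finset.filter_congr fun p _ ↦ ?_
    have := (Finset.mem_filter.1 hT).2
    exact ⟨fun h ↦ ⟨h.1.1, h.2⟩, fun h ↦ ⟨⟨h.1, h.2 ▸ this⟩, h.2⟩⟩
  rw [hsum desSet, Finset.sum_congr rfl fun T _ ↦ h T, ← hsum fun p ↦ p.desSetᶜ]
  congr 1
  refine Finset.filter_congr fun p _ ↦ and_congr_right fun _ ↦ ?_
  have := Finset.card_le_univ p.desSet
  rw [Finset.card_compl, Fintype.card_fin] at *
  omega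

end DescentSets

section SignedInvolutions

variable {n : ℕ}

theorem mem_omegaSet_iff_s4 {a : ℤ} : a ∈ OmegaSet n ↔ 0 < a.natAbs ∧ a.natAbs ≤ n := by
  simp only [OmegaSet, Set.mem_ofPred_eq, Int.abs_eq_natAbs]
  omega

namespace SignedPair

/-- The entry at the position `i + 1`. -/
def entry (p : SignedPair n) (i : Fin n) : ℤ :=
  if p.2 i = true then ((p.1 i).val : ℤ) + 1 else -(((p.1 i).val : ℤ) + 1)

/-- The signed permutation encoded by a pair. -/
def toFun (p : SignedPair n) (a : ℤ) : ℤ :=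
  if h : 0 < a.natAbs ∧ a.natAbs ≤ n then
    a.sign * p.entry ⟨a.natAbs - 1, by omega⟩
  else a

theorem toFun_add_one (p : SignedPair n) (i : Fin n) : p.toFun ((i.val : ℤ) + 1) = p.entry i := by
  have h : ((i.val : ℤ) + 1).natAbs = i.val + 1 := by omega
  have hs : ((i.val : ℤ) + 1).sign = 1 := Int.sign_eq_one_of_pos (by omega)
  rw [toFun, dif_pos (by omega), hs, one_mul]
  simp only [h, Nat.add_sub_cancel]

theorem toFun_neg (p : SignedPair n) (a : ℤ) : p.toFun (-a) = -p.toFun a := by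
  unfold toFun
  simp only [Int.natAbs_neg, Int.sign_neg]
  split_ifs <;> ring

theorem toFun_of_notMem (p : SignedPair n) {a : ℤ} (ha : a ∉ OmegaSet n) : p.toFun a = a := by
  rw [mem_omegaSet_iff_s4] at ha
  rw [toFun, dif_neg ha]

theorem toFun_zero (p : SignedPair n) : p.toFun 0 = 0 := by
  simp [toFun]

end SignedPair

/-- Odd functions fixing everything outside `OmegaSet n` are determined by their entries. -/
theorem eq_of_eq_on_entries {f g : ℤ → ℤ} (hf : ∀ a, f (-a) = -f a) (hg : ∀ a, g (-a) = -g a)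
    (hout : ∀ a, a ∉ OmegaSet n → f a = g a)
    (h : ∀ i : Fin n, f ((i.val : ℤ) + 1) = g ((i.val : ℤ) + 1)) (a : ℤ) : f a = g a := by
  by_cases ha : a ∈ OmegaSet n
  · rw [mem_omegaSet_iff_s4] at ha
    have key := h ⟨a.natAbs - 1, by omega⟩
    have e : (((a.natAbs - 1 : ℕ) : ℤ) + 1) = a.natAbs := by omega
    simp only [e] at key
    rcases Int.natAbs_eq a with h' | h' <;> rw [h']
    · exact key
    · rw [hf, hg, key]
  · exact hout a ha

namespace SignedPair

theorem IsInvol.toFun_toFun {p : SignedPair n} (hp : p.IsInvol) (a : ℤ) :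
    p.toFun (p.toFun a) = a := by
  refine eq_of_eq_on_entries (n := n) (f := fun a ↦ p.toFun (p.toFun a)) (g := id)
    (fun a ↦ by simp only [toFun_neg]) (fun a ↦ rfl)
    (fun a ha ↦ by simp only [p.toFun_of_notMem ha, id]) (fun i ↦ ?_) a
  simp only [toFun_add_one, id]
  by_cases h : p.2 i = true
  · simp [entry, h, toFun_add_one, hp.1, hp.2]
  · rw [entry, if_neg h, toFun_neg, toFun_add_one, entry, hp.2, if_neg h, hp.1, neg_neg]

theorem toFun_mem_omegaSet (p : SignedPair n) {a : ℤ} (ha : a ∈ OmegaSet n) :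
    p.toFun a ∈ OmegaSet n := by
  rw [mem_omegaSet_iff_s4] at ha ⊢
  have hs : a.sign.natAbs = 1 := Int.natAbs_sign_of_ne_zero (by omega)
  rw [toFun, dif_pos ha, Int.natAbs_mul, hs, one_mul, entry]
  split_ifs <;> omega

theorem IsInvol.isSignedInvolution {p : SignedPair n} (hp : p.IsInvol) :
    IsSignedInvolution n p.toFun := by
  refine ⟨⟨p.toFun_neg, ⟨fun a ↦ p.toFun_mem_omegaSet, ?_, ?_⟩, fun a ↦ p.toFun_of_notMem⟩,
    hp.toFun_toFun⟩
  · exact (Function.LeftInverse.injective hp.toFun_toFun).injOn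
  · exact fun a ha ↦ ⟨p.toFun a, p.toFun_mem_omegaSet ha, hp.toFun_toFun a⟩

theorem toFun_injective : Function.Injective (toFun (n := n)) := by
  intro p q h
  have he (i) : p.entry i = q.entry i := by
    rw [← toFun_add_one, ← toFun_add_one, h]
  have hi (i) : p.2 i = q.2 i ∧ p.1 i = q.1 i := by
    have := he i
    unfold entry at this
    rw [Fin.ext_iff]
    split_ifs at this with h1 h2 h2
    · exact ⟨h1.trans h2.symm, by omega⟩
    · omega
    · omega
    · exact ⟨by simp_all, by omega⟩
  exact Prod.ext (Equiv.ext fun i ↦ (hi i).2) (funext fun i ↦ (hi i).1)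

end SignedPair

theorem IsSignedInvolution.exists_toFun_eq {w : ℤ → ℤ} (hw : IsSignedInvolution n w) :
    ∃ p : SignedPair n, p.IsInvol ∧ p.toFun = w := by
  have hmem (i : Fin n) : 0 < (w ((i.val : ℤ) + 1)).natAbs ∧ (w ((i.val : ℤ) + 1)).natAbs ≤ n :=
    mem_omegaSet_iff_s4.1 (hw.1.2.1.mapsTo (mem_omegaSet_iff_s4.2 (by omega)))
  let f (i : Fin n) : Fin n := ⟨(w ((i.val : ℤ) + 1)).natAbs - 1, by have := hmem i; omega⟩
  let ε (i : Fin n) : Bool := decide (0 < w ((i.val : ℤ) + 1))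
  have hf (i) : (((f i).val : ℤ) + 1) = (w ((i.val : ℤ) + 1)).natAbs := by
    have := hmem i
    simp only [f]
    omega
  have hwf (i) : w (((f i).val : ℤ) + 1) =
      if ε i = true then (i.val : ℤ) + 1 else -((i.val : ℤ) + 1) := by
    rw [hf]
    by_cases h : 0 < w ((i.val : ℤ) + 1)
    · rw [Int.natAbs_of_nonneg h.le, hw.2, if_pos (by simpa [ε] using h)]
    · rw [Int.ofNat_natAbs_of_nonpos (by omega), hw.1.1, hw.2, if_neg (by simpa [ε] using h)]
  have hff (i) : f (f i) = i := by
    apply Fin.ext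
    have h1 := hf (f i)
    rw [hwf] at h1
    split_ifs at h1 <;> omega
  have hεf (i) : ε (f i) = ε i := by
    have h1 := hwf i
    rw [Bool.eq_iff_iff]
    conv_lhs => simp only [ε, decide_eq_true_eq]
    rw [h1]
    split_ifs with h <;> simp only [h] <;> simp
  let p : SignedPair n := (Function.Involutive.toPerm f hff, ε)
  refine ⟨p, ⟨hff, hεf⟩, funext ?_⟩
  refine eq_of_eq_on_entries (n := n) p.toFun_neg hw.1.1
    (fun a ha ↦ by rw [p.toFun_of_notMem ha, hw.1.2.2 a ha]) fun i ↦ ?_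
  rw [SignedPair.toFun_add_one]
  have h1 := hf i
  change (if ε i = true then ((f i).val : ℤ) + 1 else -(((f i).val : ℤ) + 1)) = _
  rw [h1]
  simp only [ε, decide_eq_true_eq]
  split_ifs <;> omega

namespace SignedPair

theorem rlt_entry_iff (p : SignedPair n) (i j : Fin n) :
    rlt (p.entry i) (p.entry j) ↔ p.key i < p.key j := by
  rw [key_lt_key, Fin.lt_def]
  unfold rlt entry
  cases p.2 i <;> cases p.2 j <;> simp [-Fin.val_fin_lt, Bool.lt_iff] <;> omega

theorem desB_toFun (p : SignedPair n) : desB n p.toFun = p.desSet.card := by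
  rw [desB, desSet, Finset.card_filter, Finset.card_filter,
    ← Fin.sum_univ_eq_sum_range
      (fun i : ℕ ↦ if rlt (p.toFun ((i : ℤ) + 1)) (p.toFun (i : ℤ)) then 1 else 0)]
  refine Finset.sum_congr rfl fun j _ ↦ if_congr ?_ rfl rfl
  rcases Nat.eq_zero_or_pos j.val with hz | hpos
  · rw [isDesc_of_val_eq_zero hz, toFun_add_one, hz, Nat.cast_zero, toFun_zero]
    unfold rlt entry
    cases p.2 j <;> simp <;> omega
  · let i : Fin n := ⟨j.val - 1, by omega⟩
    have hij : i.val + 1 = j.val := by simp only [i]; omega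
    rw [isDesc_of_val_add_one hij, toFun_add_one,
      show (j.val : ℤ) = (i.val : ℤ) + 1 by omega, toFun_add_one, rlt_entry_iff]

end SignedPair

theorem InkB_eq_card (n k : ℕ) : InkB n k =
    (Finset.univ.filter fun p : SignedPair n ↦ p.IsInvol ∧ p.desSet.card = k).card := by
  rw [InkB, ← Set.ncard_coe_finset, ← Set.ncard_image_of_injective _ SignedPair.toFun_injective]
  congr 1
  ext w
  simp only [Set.mem_ofPred_eq, Finset.coe_filter, Finset.mem_univ, true_and, Set.mem_image]
  constructor
  · rintro ⟨hw, hk⟩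
    obtain ⟨p, hp, rfl⟩ := hw.exists_toFun_eq
    exact ⟨p, ⟨hp, by rw [← SignedPair.desB_toFun, hk]⟩, rfl⟩
  · rintro ⟨p, ⟨hp, hk⟩, rfl⟩
    exact ⟨hp.isSignedInvolution, by rw [SignedPair.desB_toFun, hk]⟩

end SignedInvolutions

/-- Proposition 2.4: `I_n^B(x)` is symmetric with center of symmetry `n/2`; that is, for every
`n ≥ 1` and `0 ≤ k ≤ n`, the number of involutions `w ∈ B_n` with `des_B(w) = k` equals the
number of involutions `w ∈ B_n` with `des_B(w) = n - k`. -/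
theorem InB_palindromic (n k : ℕ) (hn : 1 ≤ n) (hk : k ≤ n) :
    InkB n k = InkB n (n - k) := by
  rw [InkB_eq_card, InkB_eq_card, SignedPair.card_filter_card_desSet n k hk]
end

section
/- (Transpose bijection on bitableaux, proof of Proposition 2.4) For every standard Young bitableau Q = (Q^+, Q^-) of size n, let Q^t be the bitableau whose positive part is the transpose of Q^- and whose negative part is the transpose of Q^+. Then Q ↦ Q^t is an involutive bijection on the set of standard Young bitableaux of size n, and des_B(Q^t) = n − des_B(Q). Consequently, the number of standard Young bitableaux of size n with des_B equal to k equals the number with des_B equal to n − k. -/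
open scoped Classical

/-- A standard Young bitableau of size `n`, encoded by its location function: entry
`i ∈ {1,…,n}` sits in the part of sign `(Q i).1` (`true` = `+`, `false` = `-`), in row
`(Q i).2.1` and column `(Q i).2.2` (rows and columns indexed from `0`, larger row index =
lower row).  We require: normalization outside `{1,…,n}`; no two entries share a cell of the
same part; the occupied cells of each part form a Young diagram (a lower set); and entries
strictly increase along rows and down columns of each part. -/
def IsSYB (n : ℕ) (Q : ℕ → Bool × ℕ × ℕ) : Prop :=
  (∀ i : ℕ, i ∉ Finset.Icc 1 n → Q i = (true, 0, 0)) ∧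
  Set.InjOn Q {i : ℕ | 1 ≤ i ∧ i ≤ n} ∧
  (∀ (s : Bool) (r c r' c' : ℕ), (∃ i ∈ Finset.Icc 1 n, Q i = (s, r, c)) → r' ≤ r → c' ≤ c →
    ∃ i ∈ Finset.Icc 1 n, Q i = (s, r', c')) ∧
  (∀ i ∈ Finset.Icc 1 n, ∀ j ∈ Finset.Icc 1 n,
    (Q i).1 = (Q j).1 → (Q i).2.1 = (Q j).2.1 → (Q i).2.2 < (Q j).2.2 → i < j) ∧
  (∀ i ∈ Finset.Icc 1 n, ∀ j ∈ Finset.Icc 1 n,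
    (Q i).1 = (Q j).1 → (Q i).2.2 = (Q j).2.2 → (Q i).2.1 < (Q j).2.1 → i < j)

/-- The signed descent set of a bitableau: those `i ∈ {1,…,n-1}` with either `ε_i = +` and
`ε_{i+1} = -`, or `ε_i = ε_{i+1}` and `i+1` in a lower row than `i`. -/
def sDesSetQ (n : ℕ) (Q : ℕ → Bool × ℕ × ℕ) : Finset ℕ :=
  (Finset.Icc 1 (n - 1)).filter fun i : ℕ =>
    ((Q i).1 = true ∧ (Q (i + 1)).1 = false) ∨
      ((Q i).1 = (Q (i + 1)).1 ∧ (Q i).2.1 < (Q (i + 1)).2.1)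

/-- `des_B(Q) = |Des(Q)|` if `ε_1 = +`, and `des_B(Q) = |Des(Q)| + 1` if `ε_1 = -`. -/
def desBQ (n : ℕ) (Q : ℕ → Bool × ℕ × ℕ) : ℕ :=
  (sDesSetQ n Q).card + if (Q 1).1 = false then 1 else 0

/-- The transpose `Q ↦ Qᵗ`: the positive part of `Qᵗ` is the transpose of the negative part of
`Q` and vice versa; i.e. every entry's sign is flipped and its row and column are exchanged. -/
def transposeSYB (n : ℕ) (Q : ℕ → Bool × ℕ × ℕ) : ℕ → Bool × ℕ × ℕ :=
  fun i => if i ∈ Finset.Icc 1 n then (!(Q i).1, (Q i).2.2, (Q i).2.1) else Q i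

theorem transposeSYB_apply_of_mem {n i : ℕ} (hi : i ∈ Finset.Icc 1 n) (Q : ℕ → Bool × ℕ × ℕ) :
    transposeSYB n Q i = (!(Q i).1, (Q i).2.2, (Q i).2.1) :=
  if_pos hi

theorem transposeSYB_apply_of_notMem {n i : ℕ} (hi : i ∉ Finset.Icc 1 n)
    (Q : ℕ → Bool × ℕ × ℕ) : transposeSYB n Q i = Q i :=
  if_neg hi

theorem transposeSYB_involutive (n : ℕ) : Function.Involutive (transposeSYB n) := by
  intro Q
  funext i
  by_cases hi : i ∈ Finset.Icc 1 n
  · simp [transposeSYB_apply_of_mem hi]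
  · simp [transposeSYB_apply_of_notMem hi]

theorem IsSYB.transposeSYB {n : ℕ} {Q : ℕ → Bool × ℕ × ℕ} (hQ : IsSYB n Q) :
    IsSYB n (transposeSYB n Q) := by
  obtain ⟨h_out, h_inj, h_lower, h_row, h_col⟩ := hQ
  refine ⟨fun i hi => ?_, fun i hi j hj hij => ?_, ?_, fun i hi j hj => ?_, fun i hi j hj => ?_⟩
  · rw [transposeSYB_apply_of_notMem hi, h_out i hi]
  · rw [transposeSYB_apply_of_mem (Finset.mem_Icc.2 hi),
      transposeSYB_apply_of_mem (Finset.mem_Icc.2 hj)] at hij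
    simp only [Prod.mk.injEq, Bool.not_inj_iff] at hij
    exact h_inj hi hj (Prod.ext hij.1 (Prod.ext hij.2.2 hij.2.1))
  · rintro s r c r' c' ⟨i, hi, hQi⟩ hr hc
    rw [transposeSYB_apply_of_mem hi] at hQi
    simp only [Prod.mk.injEq] at hQi
    obtain ⟨j, hj, hQj⟩ := h_lower (!s) c r c' r'
      ⟨i, hi, Prod.ext (by simp [← hQi.1]) (Prod.ext hQi.2.2 hQi.2.1)⟩ hc hr
    exact ⟨j, hj, by simp [transposeSYB_apply_of_mem hj, hQj]⟩
  · simpa [transposeSYB_apply_of_mem hi, transposeSYB_apply_of_mem hj] using h_col i hi j hj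
  · simpa [transposeSYB_apply_of_mem hi, transposeSYB_apply_of_mem hj] using h_row i hi j hj

/-- Consecutive entries of the same sign: the later one is in a lower row if and only if it is
not in a column further to the right. -/
theorem IsSYB.row_lt_succ_iff {n : ℕ} {Q : ℕ → Bool × ℕ × ℕ} (hQ : IsSYB n Q) {i : ℕ}
    (hi : i ∈ Finset.Icc 1 n) (hi' : i + 1 ∈ Finset.Icc 1 n) (hs : (Q i).1 = (Q (i + 1)).1) :
    (Q i).2.1 < (Q (i + 1)).2.1 ↔ ¬ (Q i).2.2 < (Q (i + 1)).2.2 := by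
  obtain ⟨-, h_inj, h_lower, h_row, h_col⟩ := hQ
  constructor
  · intro hr hc
    obtain ⟨j, hj, hQj⟩ := h_lower (Q (i + 1)).1 (Q (i + 1)).2.1 (Q (i + 1)).2.2
      (Q i).2.1 (Q (i + 1)).2.2 ⟨i + 1, hi', rfl⟩ hr.le le_rfl
    have h₁ := h_row i hi j hj (by simp [hQj, hs]) (by simp [hQj]) (by simpa [hQj] using hc)
    have h₂ := h_col j hj (i + 1) hi' (by simp [hQj]) (by simp [hQj]) (by simpa [hQj] using hr)
    omega
  · intro hc
    by_contra hr
    rw [not_lt] at hc hr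
    obtain ⟨j, hj, hQj⟩ := h_lower (Q i).1 (Q i).2.1 (Q i).2.2
      (Q (i + 1)).2.1 (Q i).2.2 ⟨i, hi, rfl⟩ hr le_rfl
    have h₁ : i + 1 ≤ j := by
      rcases hc.lt_or_eq with hlt | heq
      · exact (h_row (i + 1) hi' j hj (by simp [hQj, hs]) (by simp [hQj])
          (by simpa [hQj] using hlt)).le
      · exact (h_inj (Finset.mem_Icc.1 hi') (Finset.mem_Icc.1 hj)
          (by rw [hQj, hs, ← heq])).le
    have h₂ : j ≤ i := by
      rcases hr.lt_or_eq with hlt | heq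
      · exact (h_col j hj i hi (by simp [hQj]) (by simp [hQj]) (by simpa [hQj] using hlt)).le
      · exact (h_inj (Finset.mem_Icc.1 hj) (Finset.mem_Icc.1 hi) (by rw [hQj, heq])).le
    omega

theorem IsSYB.sDesSetQ_transposeSYB {n : ℕ} {Q : ℕ → Bool × ℕ × ℕ} (hQ : IsSYB n Q) :
    sDesSetQ n (_root_.transposeSYB n Q) = Finset.Icc 1 (n - 1) \ sDesSetQ n Q := by
  ext i
  simp only [sDesSetQ, Finset.mem_sdiff, Finset.mem_filter, not_and]
  refine and_congr_right fun hi => ?_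
  have h₁ : i ∈ Finset.Icc 1 n := by
    simp only [Finset.mem_Icc] at hi ⊢; omega
  have h₂ : i + 1 ∈ Finset.Icc 1 n := by
    simp only [Finset.mem_Icc] at hi ⊢; omega
  have key := hQ.row_lt_succ_iff h₁ h₂
  rw [transposeSYB_apply_of_mem h₁, transposeSYB_apply_of_mem h₂]
  simp only [hi, true_imp_iff]
  cases hs : (Q i).1 <;> cases hs' : (Q (i + 1)).1 <;> simp_all

theorem IsSYB.desBQ_transposeSYB_add {n : ℕ} {Q : ℕ → Bool × ℕ × ℕ} (hQ : IsSYB n Q) :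
    desBQ n (_root_.transposeSYB n Q) + desBQ n Q = n := by
  rcases n.eq_zero_or_pos with rfl | hn
  · simp [desBQ, sDesSetQ, _root_.transposeSYB, hQ.1 1]
  · have hsub : sDesSetQ n Q ⊆ Finset.Icc 1 (n - 1) := Finset.filter_subset _ _
    have hcard := Finset.card_sdiff_add_card_eq_card hsub
    rw [Nat.card_Icc] at hcard
    rw [desBQ, desBQ, hQ.sDesSetQ_transposeSYB,
      transposeSYB_apply_of_mem (Finset.mem_Icc.2 ⟨le_rfl, hn⟩)]
    cases (Q 1).1 <;> simp <;> omega

/-- The transpose map is an involutive bijection on standard Young bitableaux of size `n`,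
it satisfies `des_B(Qᵗ) = n - des_B(Q)`, and consequently the number of standard Young
bitableaux of size `n` with `des_B = k` equals the number with `des_B = n - k`. -/
theorem transposeSYB_bijection (n : ℕ) :
    Set.BijOn (transposeSYB n) {Q | IsSYB n Q} {Q | IsSYB n Q} ∧
    (∀ Q : ℕ → Bool × ℕ × ℕ, transposeSYB n (transposeSYB n Q) = Q) ∧
    (∀ Q : ℕ → Bool × ℕ × ℕ, IsSYB n Q → desBQ n (transposeSYB n Q) = n - desBQ n Q) ∧
    (∀ k : ℕ, k ≤ n →
      {Q | IsSYB n Q ∧ desBQ n Q = k}.ncard = {Q | IsSYB n Q ∧ desBQ n Q = n - k}.ncard) := by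
  have hinv := transposeSYB_involutive n
  refine ⟨⟨fun Q hQ => IsSYB.transposeSYB hQ, hinv.injective.injOn,
    fun Q hQ => ⟨transposeSYB n Q, IsSYB.transposeSYB hQ, hinv Q⟩⟩, hinv,
    fun Q hQ => Nat.eq_sub_of_add_eq hQ.desBQ_transposeSYB_add, fun k hk => ?_⟩
  refine Set.ncard_congr (fun Q _ => transposeSYB n Q) ?_ (fun _ _ _ _ h => hinv.injective h) ?_
  · rintro Q ⟨hQ, hdes⟩
    exact ⟨hQ.transposeSYB, by have := hQ.desBQ_transposeSYB_add; omega⟩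
  · rintro Q ⟨hQ, hdes⟩
    exact ⟨transposeSYB n Q,
      ⟨hQ.transposeSYB, by have := hQ.desBQ_transposeSYB_add; omega⟩, hinv Q⟩
end

section
/- (Recurrence for r(n,m), equation (10)) For all integers n ≥ 3 and m ≥ 0, n·r(n,m) = (2m+1)·r(n−1,m) + (2m^2 + 2m + n − 1)·r(n−2,m). -/
/-- `r(n,m) = ∑_{j=0}^{⌊n/2⌋} C(m² + j - 1, j) ⬝ C(2m + n - 2j, n - 2j)`.
(For `m = 0, j = 0` the truncated subtraction gives `C(m² + j - 1, j) = C(0,0) = 1`, the correct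
value of the multiset coefficient.) -/
def rnm (n m : ℕ) : ℕ :=
  ∑ j ∈ Finset.range (n / 2 + 1),
    Nat.choose (m ^ 2 + j - 1) j * Nat.choose (2 * m + n - 2 * j) (n - 2 * j)

theorem Nat.succ_mul_choose_add_pred (a j : ℕ) :
    (j + 1) * (a + (j + 1) - 1).choose (j + 1) = (a + j) * (a + j - 1).choose j := by
  rcases Nat.eq_zero_or_pos (a + j) with h | h
  · obtain ⟨rfl, rfl⟩ : a = 0 ∧ j = 0 := by omega
    simp
  · obtain ⟨c, hc⟩ := Nat.exists_eq_add_of_lt h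
    have h₁ : a + (j + 1) - 1 = c + 1 := by omega
    have h₂ : a + j - 1 = c := by omega
    have h₃ : a + j = c + 1 := by omega
    rw [h₁, h₂, h₃, Nat.add_one_mul_choose_eq, mul_comm]

/-- The first moment of `rnm` with respect to the index of the second binomial factor. -/
def rnmUpperMoment (n m : ℕ) : ℕ :=
  ∑ j ∈ Finset.range (n / 2 + 1), (n - 2 * j) *
    (Nat.choose (m ^ 2 + j - 1) j * Nat.choose (2 * m + n - 2 * j) (n - 2 * j))

/-- The first moment of `rnm` with respect to the index of the first binomial factor. -/
def rnmLowerMoment (n m : ℕ) : ℕ :=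
  ∑ j ∈ Finset.range (n / 2 + 1), j *
    (Nat.choose (m ^ 2 + j - 1) j * Nat.choose (2 * m + n - 2 * j) (n - 2 * j))

theorem mul_rnm_eq_moments (n m : ℕ) :
    n * rnm n m = 2 * rnmLowerMoment n m + rnmUpperMoment n m := by
  unfold rnm rnmLowerMoment rnmUpperMoment
  rw [Finset.mul_sum, Finset.mul_sum, ← Finset.sum_add_distrib]
  refine Finset.sum_congr rfl fun j hj => ?_
  have hj' : n = 2 * j + (n - 2 * j) := by
    have := Finset.mem_range.1 hj
    omega
  rw [← mul_assoc 2, ← add_mul, ← hj']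

theorem rnmUpperMoment_succ (n m : ℕ) :
    rnmUpperMoment (n + 1) m = (2 * m + 1) * rnm n m + rnmUpperMoment n m := by
  have h : rnmUpperMoment (n + 1) m = ∑ j ∈ Finset.range (n / 2 + 1), (n + 1 - 2 * j) *
      (Nat.choose (m ^ 2 + j - 1) j *
        Nat.choose (2 * m + (n + 1) - 2 * j) (n + 1 - 2 * j)) := by
    refine (Finset.sum_subset (Finset.range_mono (by omega)) fun j _ hj => ?_).symm
    have hj' : n + 1 - 2 * j = 0 := by
      have := Finset.mem_range.not.1 hj
      omega
    rw [hj', zero_mul]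
  rw [h]
  unfold rnm rnmUpperMoment
  rw [Finset.mul_sum, ← Finset.sum_add_distrib]
  refine Finset.sum_congr rfl fun j hj => ?_
  obtain ⟨k, rfl⟩ : ∃ k, n = 2 * j + k := by
    have := Finset.mem_range.1 hj
    exact ⟨n - 2 * j, by omega⟩
  have h₁ : 2 * j + k + 1 - 2 * j = k + 1 := by omega
  have h₂ : 2 * m + (2 * j + k + 1) - 2 * j = 2 * m + 1 + (k + 1) - 1 := by omega
  have h₃ : 2 * m + (2 * j + k) - 2 * j = 2 * m + 1 + k - 1 := by omega
  have h₄ : 2 * j + k - 2 * j = k := by omega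
  rw [h₁, h₂, h₃, h₄, mul_left_comm, Nat.succ_mul_choose_add_pred]
  ring

theorem rnmLowerMoment_add_two (n m : ℕ) :
    rnmLowerMoment (n + 2) m = m ^ 2 * rnm n m + rnmLowerMoment n m := by
  unfold rnm rnmLowerMoment
  rw [Finset.mul_sum, ← Finset.sum_add_distrib, Nat.add_div_right n two_pos,
    Finset.sum_range_succ', zero_mul, add_zero]
  refine Finset.sum_congr rfl fun j _ => ?_
  have h₁ : n + 2 - 2 * (j + 1) = n - 2 * j := by omega
  have h₂ : 2 * m + (n + 2) - 2 * (j + 1) = 2 * m + n - 2 * j := by omega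
  rw [h₁, h₂, ← mul_assoc, Nat.succ_mul_choose_add_pred]
  ring

/-- Recurrence (10) for `r(n,m)`: for all `n ≥ 3` and `m ≥ 0`,
`n·r(n,m) = (2m+1)·r(n-1,m) + (2m² + 2m + n - 1)·r(n-2,m)`. -/
theorem rnm_recurrence (n m : ℕ) (hn : 3 ≤ n) :
    n * rnm n m = (2 * m + 1) * rnm (n - 1) m + (2 * m ^ 2 + 2 * m + n - 1) * rnm (n - 2) m := by
  obtain ⟨k, rfl⟩ : ∃ k, n = k + 2 := ⟨n - 2, by omega⟩
  have h₁ : k + 2 - 1 = k + 1 := by omega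
  have h₂ : 2 * m ^ 2 + 2 * m + (k + 2) - 1 = 2 * m ^ 2 + 2 * m + k + 1 := by omega
  rw [h₁, h₂, Nat.add_sub_cancel, mul_rnm_eq_moments, rnmLowerMoment_add_two,
    rnmUpperMoment_succ, rnmUpperMoment_succ]
  linarith [mul_rnm_eq_moments k m]
end
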